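/- arXiv:1610.06990 — 2 statements merged into one kernel-verified Lean document; each statement's English description precedes it below -/
import Mathlib

section
/- Let i ∈ {1,…,n}, a ∈ ℕ, and let I ⊆ K{y_1,…,y_n} be a pure binomial σ-ideal. Then ⟨I ∪ {y_i^{x^a}}⟩_r is a finite intersection of radical well-mixed σ-ideals, each of the form ⟨J ∪ {y_{j_1}^{x^{b_{j_1}}},…,y_{j_t}^{x^{b_{j_t}}}}⟩_r where J is a pure binomial σ-ideal containing I, i ∈ {j_1,…,j_t}, and for each such member either J ⊆ [y_{j_1}^{x^{b_{j_1}}},…,y_{j_t}^{x^{b_{j_t}}}] or ⟨J ∪ {y_{j_1}^{x^{b_{j_1}}},…,y_{j_t}^{x^{b_{j_t}}}}⟩_r is quasi-normal. -/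
open Polynomial

section SigmaRing

variable {R : Type*} [CommRing R]

/-- A σ-ideal: an ideal closed under the difference operator σ. -/
def IsSigmaIdeal (σ : R →+* R) (I : Ideal R) : Prop := ∀ a ∈ I, σ a ∈ I

/-- A σ-ideal is well-mixed if `a * b ∈ I` implies `a * σ b ∈ I`. -/
def IsWellMixed (σ : R →+* R) (I : Ideal R) : Prop := ∀ a b : R, a * b ∈ I → a * σ b ∈ I

/-- `[F]`, the smallest σ-ideal containing `F`. -/
def sigmaIdealGen (σ : R →+* R) (F : Set R) : Ideal R :=
  sInf {I : Ideal R | F ⊆ I ∧ IsSigmaIdeal σ I}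

/-- `⟨F⟩`, the smallest well-mixed σ-ideal containing `F` (well-mixed closure). -/
def wmClosure (σ : R →+* R) (F : Set R) : Ideal R :=
  sInf {I : Ideal R | F ⊆ I ∧ IsSigmaIdeal σ I ∧ IsWellMixed σ I}

/-- `⟨F⟩_r`, the smallest radical well-mixed σ-ideal containing `F`. -/
def rwmClosure (σ : R →+* R) (F : Set R) : Ideal R :=
  sInf {I : Ideal R | F ⊆ I ∧ IsSigmaIdeal σ I ∧ IsWellMixed σ I ∧ I.IsRadical}

/-- Symbolic exponent: for `p = Σ c_i x^i ∈ ℕ[x]`, `a^p = Π (σ^i a)^(c_i)`. -/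
noncomputable def sexp (σ : R →+* R) (a : R) (p : Polynomial ℕ) : R :=
  ∏ i ∈ Finset.range (p.natDegree + 1), ((⇑σ)^[i] a) ^ (p.coeff i)

/-- `I` is finitely generated as a radical well-mixed σ-ideal. -/
def FinGenAsRWM (σ : R →+* R) (I : Ideal R) : Prop :=
  ∃ G : Set R, G.Finite ∧ G ⊆ (I : Set R) ∧ I = rwmClosure σ G

/-- σ-prime: a reflexive σ-ideal which is prime. -/
def IsSigmaPrime (σ : R →+* R) (I : Ideal R) : Prop :=
  IsSigmaIdeal σ I ∧ (∀ a : R, σ a ∈ I → a ∈ I) ∧ I.IsPrime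

end SigmaRing

/-- The σ-polynomial ring `K{y_1,…,y_n}`: polynomials in variables `y_i^{x^j}`,
indexed by pairs `(i, j) ∈ Fin n × ℕ`. -/
abbrev DPoly (K : Type*) [Field K] (n : ℕ) := MvPolynomial (Fin n × ℕ) K

section DPoly

variable {K : Type*} [Field K] {n : ℕ} (σK : K →+* K)

/-- The difference operator on `K{y_1,…,y_n}` extending `σK`, with `σ(y_i^{x^j}) = y_i^{x^{j+1}}`. -/
noncomputable def shift : DPoly K n →+* DPoly K n :=
  MvPolynomial.eval₂Hom ((MvPolynomial.C : K →+* DPoly K n).comp σK)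
    (fun v => MvPolynomial.X (v.1, v.2 + 1))

/-- `y_i^p` for `p ∈ ℕ[x]`. -/
noncomputable def ypow (i : Fin n) (p : Polynomial ℕ) : DPoly K n :=
  sexp (shift σK) (MvPolynomial.X (i, 0)) p

/-- `y_i^{x^a}`. -/
noncomputable def varPow (i : Fin n) (a : ℕ) : DPoly K n :=
  ypow σK i (Polynomial.X ^ a)

/-- The monomial `Y^f = Π y_i^{f_i}` for `f ∈ ℕ[x]^n`. -/
noncomputable def monom (f : Fin n → Polynomial ℕ) : DPoly K n :=
  ∏ i, ypow σK i (f i)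

/-- A pure binomial `Y^f − Y^g`. -/
def IsPureBinomial (p : DPoly K n) : Prop :=
  ∃ f g : Fin n → Polynomial ℕ, p = monom σK f - monom σK g

/-- A binomial `a·Y^f + b·Y^g` with `a, b ∈ K^×`. -/
def IsBinomial (p : DPoly K n) : Prop :=
  ∃ (a b : K) (f g : Fin n → Polynomial ℕ), a ≠ 0 ∧ b ≠ 0 ∧
    p = MvPolynomial.C a * monom σK f + MvPolynomial.C b * monom σK g

/-- A pure binomial σ-ideal: a σ-ideal generated by pure binomials. -/
def IsPureBinomialSigmaIdeal (I : Ideal (DPoly K n)) : Prop :=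
  ∃ S : Set (DPoly K n), (∀ p ∈ S, IsPureBinomial σK p) ∧ I = sigmaIdealGen (shift σK) S

/-- Positive part of `f ∈ ℤ[x]`. -/
noncomputable def posPart (f : Polynomial ℤ) : Polynomial ℕ :=
  f.sum fun i c => Polynomial.monomial i c.toNat

/-- Negative part of `f ∈ ℤ[x]`. -/
noncomputable def negPart (f : Polynomial ℤ) : Polynomial ℕ :=
  f.sum fun i c => Polynomial.monomial i (-c).toNat

/-- The lattice σ-ideal `I_L = [Y^{f_+} − Y^{f_−} : f ∈ L]` of a ℤ[x]-lattice `L ⊆ ℤ[x]^n`. -/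
noncomputable def latticeIdeal (L : Submodule (Polynomial ℤ) (Fin n → Polynomial ℤ)) :
    Ideal (DPoly K n) :=
  sigmaIdealGen (shift σK)
    {p | ∃ f ∈ L, p = monom σK (fun i => posPart (f i)) - monom σK (fun i => negPart (f i))}

end DPoly

/-- `𝔪`: the multiplicatively closed set generated by the variables `y_i^{x^j}`. -/
def mSet (K : Type*) [Field K] (n : ℕ) : Set (DPoly K n) :=
  (Submonoid.closure (Set.range fun v : Fin n × ℕ => (MvPolynomial.X v : DPoly K n)) : Set _)

/-- `I : 𝔪 = {p : M p ∈ I for some M ∈ 𝔪}`. -/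
def colonM {K : Type*} [Field K] {n : ℕ} (I : Ideal (DPoly K n)) : Set (DPoly K n) :=
  {p | ∃ M ∈ mSet K n, M * p ∈ I}

section Tsec

variable {K : Type*} [Field K] {n t : ℕ} (σK : K →+* K)

/-- The set `T^{a_1…a_t}_{j_1…j_t}` of monomials `Y^f` with `deg f_{j_i} < a_i`. -/
def Tset (j : Fin t → Fin n) (a : Fin t → ℕ) : Set (DPoly K n) :=
  {p | ∃ f : Fin n → Polynomial ℕ,
    (∀ i : Fin t, (f (j i)).degree < (a i : WithBot ℕ)) ∧ p = monom σK f}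

/-- `I` is saturated with respect to `{y_{j_1}^{x^{a_1}},…,y_{j_t}^{x^{a_t}}}`. -/
def SaturatedWrt (j : Fin t → Fin n) (a : Fin t → ℕ) (I : Ideal (DPoly K n)) : Prop :=
  ∀ g M : DPoly K n, M ∈ Tset σK j a → M * g ∈ I → g ∈ I

/-- `J : T = {g : M g ∈ J for some M ∈ T}`. -/
def colonT (j : Fin t → Fin n) (a : Fin t → ℕ) (J : Ideal (DPoly K n)) : Set (DPoly K n) :=
  {g | ∃ M ∈ Tset σK j a, M * g ∈ J}

/-- The `T`-saturated closure `N^{a_1…a_t}_{j_1…j_t}(I)`: the smallest saturated σ-ideal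
containing `I`. -/
noncomputable def Nclosure (j : Fin t → Fin n) (a : Fin t → ℕ) (I : Ideal (DPoly K n)) :
    Ideal (DPoly K n) :=
  sInf {J : Ideal (DPoly K n) | I ≤ J ∧ IsSigmaIdeal (shift σK) J ∧ SaturatedWrt σK j a J}

/-- The set of variables `{y_{j_1}^{x^{a_1}},…,y_{j_t}^{x^{a_t}}}`. -/
noncomputable def varSet (j : Fin t → Fin n) (a : Fin t → ℕ) : Set (DPoly K n) :=
  Set.range fun i => varPow σK (j i) (a i)

/-- `⟨I₀ ∪ {y_{j_1}^{x^{a_1}},…,y_{j_t}^{x^{a_t}}}⟩_r` is quasi-normal. -/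
def QuasiNormal (j : Fin t → Fin n) (a : Fin t → ℕ) (I0 : Ideal (DPoly K n)) : Prop :=
  SaturatedWrt σK j a I0 ∧
  ∀ f g : Fin n → Polynomial ℕ, monom σK f - monom σK g ∈ I0 →
    monom σK f ∈ sigmaIdealGen (shift σK) (varSet σK j a) →
    monom σK g ∈ sigmaIdealGen (shift σK) (varSet σK j a)

end Tsec

section Combinatorics

/-- Multiplication by `x ^ j` on exponent vectors. -/
noncomputable def expShift {n : ℕ} {M : Type*} [AddCommMonoid M] (j : ℕ) :
    (Fin n × ℕ →₀ M) →+ (Fin n × ℕ →₀ M) :=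
  Finsupp.mapDomain.addMonoidHom fun v => (v.1, v.2 + j)

/-- All exponents `x ^ l` of `y_k` occurring in `v` satisfy `l < c k`. -/
def InBounds {n : ℕ} {M : Type*} [Zero M] (c : Fin n → ℕ∞) (v : Fin n × ℕ →₀ M) : Prop :=
  ∀ k l, v (k, l) ≠ 0 → (l : ℕ∞) < c k

variable {n : ℕ} {M : Type*} [AddCommMonoid M]

lemma expShift_injective (n j : ℕ) :
    Function.Injective fun v : Fin n × ℕ => (v.1, v.2 + j) := by
  rintro ⟨a, b⟩ ⟨c, d⟩ h
  simpa using h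

@[simp] lemma expShift_apply_add (j : ℕ) (v : Fin n × ℕ →₀ M) (k : Fin n) (l : ℕ) :
    expShift j v (k, l + j) = v (k, l) :=
  Finsupp.mapDomain_apply (expShift_injective n j) v (k, l)

lemma expShift_apply_of_lt {j : ℕ} (v : Fin n × ℕ →₀ M) (k : Fin n) {l : ℕ} (h : l < j) :
    expShift j v (k, l) = 0 := by
  refine Finsupp.mapDomain_of_notMem_range _ _ ?_
  rintro ⟨⟨a, b⟩, hab⟩
  simp only [Prod.mk.injEq] at hab
  omega

lemma exists_of_expShift_ne_zero {j : ℕ} {v : Fin n × ℕ →₀ M} {k : Fin n} {l : ℕ}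
    (h : expShift j v (k, l) ≠ 0) : ∃ l', l = l' + j ∧ v (k, l') ≠ 0 := by
  rcases lt_or_ge l j with hl | hl
  · exact absurd (expShift_apply_of_lt v k hl) h
  · obtain ⟨l', rfl⟩ := Nat.exists_eq_add_of_le' hl
    exact ⟨l', rfl, by simpa using h⟩

lemma expShift_expShift (i j : ℕ) (v : Fin n × ℕ →₀ M) :
    expShift i (expShift j v) = expShift (j + i) v := by
  simp only [expShift, Finsupp.mapDomain.addMonoidHom_apply, ← Finsupp.mapDomain_comp]
  congr 1
  funext x
  simp [add_assoc]

@[simp] lemma expShift_zero (v : Fin n × ℕ →₀ M) : expShift 0 v = v := by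
  exact Finsupp.mapDomain_id

lemma expShift_mem {L : AddSubgroup (Fin n × ℕ →₀ ℤ)} (hL : ∀ v ∈ L, expShift 1 v ∈ L)
    (j : ℕ) {v : Fin n × ℕ →₀ ℤ} (hv : v ∈ L) : expShift j v ∈ L := by
  induction j with
  | zero => simpa
  | succ j ih => rw [← expShift_expShift]; exact hL _ ih

/-- A monotone map from a well-quasi-order to an order with the ascending chain condition
is determined by its values at finitely many points. -/
lemma exists_finset_le_eq_of_monotone {P Q : Type*} [Preorder P] [WellQuasiOrderedLE P]
    [PartialOrder Q] [WellFoundedGT Q] {A : P → Q} (hA : Monotone A) :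
    ∃ F : Finset P, ∀ p, ∃ q ∈ F, q ≤ p ∧ A q = A p := by
  by_contra! hF
  obtain ⟨f, -, hf⟩ := exists_seq_of_forall_finset_exists (fun _ : P => True)
    (fun q p => q ≤ p → A q ≠ A p) fun s _ => by
      obtain ⟨p, hp⟩ := hF s
      exact ⟨p, trivial, hp⟩
  obtain ⟨g, hg⟩ := (wellQuasiOrdered_le (α := P)).exists_monotone_subseq f
  obtain ⟨N, hN⟩ := WellFoundedGT.monotone_chain_condition
    (⟨fun m => A (f (g m)), fun a b h => hA (hg a b h)⟩ : ℕ →o Q)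
  exact hf _ _ (g.strictMono N.lt_succ_self) (hg _ _ N.le_succ) (hN _ N.le_succ)

/-- The coefficients at `x ^ d.1` of the `k₀`-th coordinate, among the elements of `L` supported
on `K` whose degrees are bounded in terms of `d`. -/
noncomputable def leadCoeffs (L : AddSubgroup (Fin n × ℕ →₀ ℤ)) (K : Finset (Fin n))
    (k₀ : Fin n) (d : ℕ × (Fin n → ℕ)) : AddSubgroup ℤ :=
  AddSubgroup.map (Finsupp.applyAddHom (k₀, d.1))
    { carrier := {v | v ∈ L ∧ (∀ k l, v (k, l) ≠ 0 → k ∈ K ∧ l ≤ d.1 + d.2 k) ∧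
        ∀ l, v (k₀, l) ≠ 0 → l ≤ d.1}
      zero_mem' := ⟨L.zero_mem, by simp, by simp⟩
      add_mem' := by
        rintro v w ⟨hv, hv', hv''⟩ ⟨hw, hw', hw''⟩
        refine ⟨L.add_mem hv hw, fun k l h => ?_, fun l h => ?_⟩
        · by_cases h' : v (k, l) = 0
          · exact hw' k l (by simpa [h'] using h)
          · exact hv' k l h'
        · by_cases h' : v (k₀, l) = 0
          · exact hw'' l (by simpa [h'] using h)
          · exact hv'' l h'
      neg_mem' := by
        rintro v ⟨hv, hv', hv''⟩
        exact ⟨L.neg_mem hv, by simpa using hv', by simpa using hv''⟩ }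

lemma mem_leadCoeffs {L : AddSubgroup (Fin n × ℕ →₀ ℤ)} {K : Finset (Fin n)} {k₀ : Fin n}
    {d : ℕ × (Fin n → ℕ)} {a : ℤ} :
    a ∈ leadCoeffs L K k₀ d ↔ ∃ v ∈ L, (∀ k l, v (k, l) ≠ 0 → k ∈ K ∧ l ≤ d.1 + d.2 k) ∧
      (∀ l, v (k₀, l) ≠ 0 → l ≤ d.1) ∧ v (k₀, d.1) = a := by
  simp only [leadCoeffs, AddSubgroup.mem_map]
  constructor
  · rintro ⟨v, ⟨h1, h2, h3⟩, h4⟩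
    exact ⟨v, h1, h2, h3, h4⟩
  · rintro ⟨v, h1, h2, h3, h4⟩
    exact ⟨v, ⟨h1, h2, h3⟩, h4⟩

lemma leadCoeffs_mono {L : AddSubgroup (Fin n × ℕ →₀ ℤ)} (hL : ∀ v ∈ L, expShift 1 v ∈ L)
    (K : Finset (Fin n)) (k₀ : Fin n) : Monotone (leadCoeffs L K k₀) := by
  rintro ⟨d, δ⟩ ⟨d', δ'⟩ ⟨hd, hδ⟩ a ha
  simp only at hd hδ
  obtain ⟨e, rfl⟩ := Nat.exists_eq_add_of_le hd
  rw [mem_leadCoeffs] at ha ⊢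
  obtain ⟨v, hv, h1, h2, h3⟩ := ha
  refine ⟨expShift e v, expShift_mem hL e hv, fun k l h => ?_, fun l h => ?_, ?_⟩
  · obtain ⟨l', rfl, h'⟩ := exists_of_expShift_ne_zero h
    obtain ⟨hk, hl⟩ := h1 k l' h'
    have : δ k ≤ δ' k := hδ k
    simp only at hl ⊢
    exact ⟨hk, by omega⟩
  · obtain ⟨l', rfl, h'⟩ := exists_of_expShift_ne_zero h
    have := h2 l' h'
    simp only at this ⊢
    omega
  · simpa using h3

/-- The subgroup generated by those shifts of elements of `G` which respect the bounds `c`. -/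
noncomputable def boundedSpan (G : Set (Fin n × ℕ →₀ ℤ)) (c : Fin n → ℕ∞) :
    AddSubgroup (Fin n × ℕ →₀ ℤ) :=
  AddSubgroup.closure {w | ∃ g ∈ G, ∃ j, w = expShift j g ∧ InBounds c w}

lemma boundedSpan_mono {G G' : Set (Fin n × ℕ →₀ ℤ)} {c c' : Fin n → ℕ∞} (hG : G ⊆ G')
    (hc : c ≤ c') : boundedSpan G c ≤ boundedSpan G' c' := by
  refine AddSubgroup.closure_mono ?_
  rintro w ⟨g, hg, j, hw, hb⟩
  exact ⟨g, hG hg, j, hw, fun k l h => (hb k l h).trans_le (hc k)⟩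

/-- The inductive step of `exists_finite_boundedSpan_nat`: eliminating a coordinate with the
smallest bound. -/
lemma exists_finite_boundedSpan_of_erase {L : AddSubgroup (Fin n × ℕ →₀ ℤ)}
    (hL : ∀ v ∈ L, expShift 1 v ∈ L) (K : Finset (Fin n)) (k₀ : Fin n)
    {G : Set (Fin n × ℕ →₀ ℤ)} (hfin : G.Finite) (hGL : G ⊆ L)
    (hG : ∀ c : Fin n → ℕ, ∀ v ∈ L, (∀ k l, v (k, l) ≠ 0 → k ∈ K.erase k₀ ∧ l < c k) →
      v ∈ boundedSpan G fun k => c k) :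
    ∃ G' : Set (Fin n × ℕ →₀ ℤ), G'.Finite ∧ G' ⊆ L ∧ ∀ c : Fin n → ℕ, (∀ k ∈ K, c k₀ ≤ c k) →
      ∀ v ∈ L, (∀ k l, v (k, l) ≠ 0 → k ∈ K ∧ l < c k) → v ∈ boundedSpan G' fun k => c k := by
  have : WellFoundedGT (AddSubgroup ℤ) :=
    (AddSubgroup.toIntSubmodule (M := ℤ)).toOrderEmbedding.wellFoundedGT
  obtain ⟨F, hF⟩ := exists_finset_le_eq_of_monotone (leadCoeffs_mono hL K k₀)
  have key : ∀ q : ℕ × (Fin n → ℕ), ∃ g ∈ L,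
      (∀ k l, g (k, l) ≠ 0 → k ∈ K ∧ l ≤ q.1 + q.2 k) ∧ (∀ l, g (k₀, l) ≠ 0 → l ≤ q.1) ∧
      ∀ a ∈ leadCoeffs L K k₀ q, ∃ m : ℤ, a = m * g (k₀, q.1) := by
    intro q
    obtain ⟨a, ha⟩ := Int.subgroup_cyclic (leadCoeffs L K k₀ q)
    have ha' : a ∈ leadCoeffs L K k₀ q := by
      rw [ha]; exact AddSubgroup.subset_closure rfl
    obtain ⟨g, h1, h2, h3, h4⟩ := mem_leadCoeffs.1 ha'
    refine ⟨g, h1, h2, h3, fun b hb => ?_⟩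
    rw [ha, AddSubgroup.mem_closure_singleton] at hb
    obtain ⟨m, hm⟩ := hb
    exact ⟨m, by simp [h4, ← hm]⟩
  choose g hgL hg1 hg2 hg3 using key
  refine ⟨G ∪ g '' F, hfin.union (F.finite_toSet.image g), ?_, ?_⟩
  · rintro v (hv | ⟨q, -, rfl⟩)
    exacts [hGL hv, hgL q]
  intro c hc
  suffices H : ∀ e ≤ c k₀, ∀ v ∈ L, (∀ k l, v (k, l) ≠ 0 → k ∈ K ∧ l < c k) →
      (∀ l, v (k₀, l) ≠ 0 → l < e) → v ∈ boundedSpan (G ∪ g '' F) fun k => c k from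
    fun v hv hb => H _ le_rfl v hv hb fun l h => (hb k₀ l h).2
  intro e
  induction e with
  | zero =>
    intro _ v hv hb h0
    refine boundedSpan_mono Set.subset_union_left le_rfl (hG c v hv fun k l h => ?_)
    refine ⟨Finset.mem_erase.2 ⟨?_, (hb k l h).1⟩, (hb k l h).2⟩
    rintro rfl
    exact absurd (h0 l h) (by omega)
  | succ d ih =>
    intro hd v hv hb h0
    obtain ⟨q, hqF, hqle, hqA⟩ := hF (d, fun k => c k - (d + 1))
    have hmem : v (k₀, d) ∈ leadCoeffs L K k₀ (d, fun k => c k - (d + 1)) := by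
      refine mem_leadCoeffs.2 ⟨v, hv, fun k l h => ?_, fun l h => ?_, rfl⟩
      · have := hb k l h
        have := hc k this.1
        exact ⟨(hb k l h).1, by simp only; omega⟩
      · have := h0 l h
        simp only; omega
    rw [← hqA] at hmem
    obtain ⟨m, hm⟩ := hg3 q _ hmem
    obtain ⟨q1, q2⟩ := q
    obtain ⟨hq1, hq2⟩ := hqle
    simp only at hq1 hq2 hm
    obtain ⟨j, rfl⟩ := Nat.exists_eq_add_of_le hq1
    set w := expShift j (g (q1, q2)) with hw
    have hwb : ∀ k l, w (k, l) ≠ 0 → k ∈ K ∧ l < c k := by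
      intro k l h
      obtain ⟨l', rfl, h'⟩ := exists_of_expShift_ne_zero h
      obtain ⟨hk, hl⟩ := hg1 _ k l' h'
      have h1 := hq2 k
      have h2 := hc k hk
      simp only at h1 hl
      exact ⟨hk, by omega⟩
    have hwd : ∀ l, w (k₀, l) ≠ 0 → l < q1 + j + 1 := by
      intro l h
      obtain ⟨l', rfl, h'⟩ := exists_of_expShift_ne_zero h
      have := hg2 _ l' h'
      simp only at this
      omega
    have hwL : w ∈ L := expShift_mem hL j (hgL _)
    have hwspan : w ∈ boundedSpan (G ∪ g '' F) fun k => c k :=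
      AddSubgroup.subset_closure ⟨_, Or.inr ⟨_, hqF, rfl⟩, j, rfl,
        fun k l h => Nat.cast_lt.2 (hwb k l h).2⟩
    have hsub : v - m • w ∈ boundedSpan (G ∪ g '' F) fun k => c k := by
      refine ih (by omega) _ (L.sub_mem hv (L.zsmul_mem hwL m)) (fun k l h => ?_) fun l h => ?_
      · by_cases h' : v (k, l) = 0
        · refine hwb k l fun h'' => h ?_
          simp [h', h'']
        · exact hb k l h'
      · have hl : l < q1 + j + 1 := by
          by_cases h' : v (k₀, l) = 0
          · refine hwd l fun h'' => h ?_
            simp [h', h'']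
          · exact h0 l h'
        refine lt_of_le_of_ne (by omega) ?_
        rintro rfl
        apply h
        simp [hw, hm]
    simpa using add_mem hsub (zsmul_mem hwspan m)

lemma exists_finite_boundedSpan_nat {L : AddSubgroup (Fin n × ℕ →₀ ℤ)}
    (hL : ∀ v ∈ L, expShift 1 v ∈ L) (K : Finset (Fin n)) :
    ∃ G : Set (Fin n × ℕ →₀ ℤ), G.Finite ∧ G ⊆ L ∧ ∀ c : Fin n → ℕ, ∀ v ∈ L,
      (∀ k l, v (k, l) ≠ 0 → k ∈ K ∧ l < c k) → v ∈ boundedSpan G fun k => c k := by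
  induction K using Finset.strongInduction with
  | H K ih =>
    rcases K.eq_empty_or_nonempty with rfl | hK
    · refine ⟨∅, Set.finite_empty, Set.empty_subset _, fun c v _ hb => ?_⟩
      have : v = 0 := by
        ext ⟨k, l⟩
        by_contra h
        simpa using (hb k l h).1
      rw [this]
      exact zero_mem _
    have step : ∀ k₀ : K, ∃ G' : Set (Fin n × ℕ →₀ ℤ), G'.Finite ∧ G' ⊆ L ∧ ∀ c : Fin n → ℕ,
        (∀ k ∈ K, c k₀ ≤ c k) → ∀ v ∈ L, (∀ k l, v (k, l) ≠ 0 → k ∈ K ∧ l < c k) →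
        v ∈ boundedSpan G' fun k => c k := by
      intro k₀
      obtain ⟨G, h1, h2, h3⟩ := ih _ (Finset.erase_ssubset k₀.2)
      exact exists_finite_boundedSpan_of_erase hL K k₀ h1 h2 h3
    choose G hfin hGL hG using step
    refine ⟨⋃ k, G k, Set.finite_iUnion hfin, Set.iUnion_subset hGL, fun c v hv hb => ?_⟩
    obtain ⟨k₀, hk₀, hmin⟩ := K.exists_min_image c hK
    exact boundedSpan_mono (Set.subset_iUnion G ⟨k₀, hk₀⟩) le_rfl (hG ⟨k₀, hk₀⟩ c hmin v hv hb)

/-- A shift-stable subgroup has a finite set of generators which, for all bounds `c` at once,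
generates the elements respecting `c` by shifts respecting `c`. -/
lemma exists_finite_boundedSpan {L : AddSubgroup (Fin n × ℕ →₀ ℤ)}
    (hL : ∀ v ∈ L, expShift 1 v ∈ L) :
    ∃ G : Set (Fin n × ℕ →₀ ℤ), G.Finite ∧ G ⊆ L ∧ ∀ c : Fin n → ℕ∞, ∀ v ∈ L,
      InBounds c v → v ∈ boundedSpan G c := by
  obtain ⟨G, h1, h2, h3⟩ := exists_finite_boundedSpan_nat hL Finset.univ
  refine ⟨G, h1, h2, fun c v hv hb => ?_⟩
  set B := v.support.sup Prod.snd with hB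
  have hle : (fun k => (((min (c k) (B + 1 : ℕ)).toNat : ℕ) : ℕ∞)) ≤ c := fun k => by
    simp only
    rw [ENat.natCast_toNat (by simp)]
    exact min_le_left _ _
  refine boundedSpan_mono subset_rfl hle (h3 _ v hv fun k l h => ⟨Finset.mem_univ _, ?_⟩)
  have hl : l ≤ B := Finset.le_sup (f := Prod.snd) (Finsupp.mem_support_iff.2 h)
  rw [← Nat.cast_lt (α := ℕ∞), ENat.natCast_toNat (by simp)]
  exact lt_min (hb k l h) (by exact_mod_cast Nat.lt_succ_of_le hl)

end Combinatorics

section SigmaPrimes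

variable {R : Type*} [CommRing R] {σ : R →+* R}

lemma subset_rwmClosure (σ : R →+* R) (F : Set R) : F ⊆ rwmClosure σ F :=
  fun _ hx => Submodule.mem_sInf.2 fun _ hI => hI.1 hx

lemma isWellMixed_rwmClosure (σ : R →+* R) (F : Set R) : IsWellMixed σ (rwmClosure σ F) :=
  fun a b h => Submodule.mem_sInf.2 fun I hI => hI.2.2.1 a b (Submodule.mem_sInf.1 h I hI)

lemma isRadical_rwmClosure (σ : R →+* R) (F : Set R) : (rwmClosure σ F).IsRadical := by
  rintro a ⟨m, hm⟩
  exact Submodule.mem_sInf.2 fun I hI => hI.2.2.2 ⟨m, Submodule.mem_sInf.1 hm I hI⟩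

lemma rwmClosure_le_of_isPrime {F : Set R} {p : Ideal R} (hp : p.IsPrime)
    (hσ : IsSigmaIdeal σ p) (hF : F ⊆ p) : rwmClosure σ F ≤ p := by
  refine sInf_le ⟨hF, hσ, fun a b h => ?_, hp.isRadical⟩
  rcases hp.mem_or_mem h with h | h
  exacts [p.mul_mem_right _ h, p.mul_mem_left _ (hσ b h)]

lemma Ideal.exists_notMem_mul_mem_of_mem_minimalPrimes {J p : Ideal R} (hJ : J.IsRadical)
    (hp : p ∈ J.minimalPrimes) {x : R} (hx : x ∈ p) : ∃ y ∉ p, y * x ∈ J := by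
  have := hp.isPrime
  by_contra! H
  obtain ⟨q, hq, hJq, hdis⟩ := J.exists_le_prime_disjoint (p.primeCompl ⊔ Submonoid.powers x) (by
    rw [Set.disjoint_left]
    intro z hz hz'
    obtain ⟨y, hy, w, ⟨m, rfl⟩, rfl⟩ := Submonoid.mem_sup.1 hz'
    refine H y hy (hJ ⟨m + 1, ?_⟩)
    have : (y * x) ^ (m + 1) = y * x ^ m * (y ^ m * x) := by ring
    rw [this]
    exact J.mul_mem_right _ hz)
  rw [Set.disjoint_left] at hdis
  have hqp : q ≤ p := fun z hz => by
    by_contra hzp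
    exact hdis hz (Submonoid.mem_sup_left hzp)
  exact hdis (hp.2 ⟨hq, hJq⟩ hqp hx) (Submonoid.mem_sup_right (Submonoid.mem_powers x))

lemma mem_rwmClosure_of_forall {F : Set R} {f : R}
    (h : ∀ p : Ideal R, p.IsPrime → IsSigmaIdeal σ p → F ⊆ p → f ∈ p) : f ∈ rwmClosure σ F := by
  rw [← (isRadical_rwmClosure σ F).radical, ← Ideal.sInf_minimalPrimes]
  refine Submodule.mem_sInf.2 fun p hp => h p hp.isPrime (fun x hx => ?_)
    ((subset_rwmClosure σ F).trans hp.le)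
  obtain ⟨y, hy, hyx⟩ :=
    Ideal.exists_notMem_mul_mem_of_mem_minimalPrimes (isRadical_rwmClosure σ F) hp hx
  exact (hp.isPrime.mem_or_mem (hp.le (isWellMixed_rwmClosure σ F _ _ hyx))).resolve_left hy

end SigmaPrimes

section Monomials

variable {K : Type*} [Field K] {n : ℕ}

/-- The monomial of `K{y_1,…,y_n}` with exponent vector `α`. -/
noncomputable abbrev mono (K : Type*) [Field K] {n : ℕ} (α : Fin n × ℕ →₀ ℕ) : DPoly K n :=
  MvPolynomial.monomial α 1

lemma mono_add (α β : Fin n × ℕ →₀ ℕ) : mono K (α + β) = mono K α * mono K β := by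
  simp [mono, MvPolynomial.monomial_mul]

lemma shift_mono (σK : K →+* K) (α : Fin n × ℕ →₀ ℕ) :
    shift σK (mono K α) = mono K (expShift 1 α) := by
  induction α using Finsupp.induction_linear with
  | zero => simp [mono]
  | add α β hα hβ => rw [map_add, mono_add, mono_add, map_mul, hα, hβ]
  | single v m =>
    simp [mono, shift, expShift, MvPolynomial.eval₂_monomial, Finsupp.mapDomain_single,
      MvPolynomial.X_pow_eq_monomial]

lemma iterate_shift_X (σK : K →+* K) (k : Fin n) (l : ℕ) :
    (⇑(shift σK))^[l] (MvPolynomial.X (k, 0)) = MvPolynomial.X (k, l) := by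
  induction l with
  | zero => rfl
  | succ l ih => rw [Function.iterate_succ_apply', ih]; simp [shift]

/-- The exponent vector of `Y^f`. -/
noncomputable def expVec (f : Fin n → ℕ[X]) : Fin n × ℕ →₀ ℕ :=
  ∑ k, ∑ l ∈ Finset.range ((f k).natDegree + 1), Finsupp.single (k, l) ((f k).coeff l)

lemma expVec_apply (f : Fin n → ℕ[X]) (k : Fin n) (l : ℕ) :
    expVec f (k, l) = (f k).coeff l := by
  classical
  rw [expVec, Finsupp.finsetSum_apply, Finset.sum_eq_single k]
  · rw [Finsupp.finsetSum_apply, Finset.sum_eq_single l]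
    · simp
    · intro b _ hb
      simp [hb]
    · intro hl
      rw [Finset.mem_range, not_lt] at hl
      simp [Polynomial.coeff_eq_zero_of_natDegree_lt (Nat.lt_of_succ_le hl)]
  · intro b _ hb
    rw [Finsupp.finsetSum_apply]
    refine Finset.sum_eq_zero fun x _ => ?_
    simp [hb]
  · simp

lemma monom_eq_mono (σK : K →+* K) (f : Fin n → ℕ[X]) : monom σK f = mono K (expVec f) := by
  simp only [monom, ypow, sexp, iterate_shift_X, expVec, mono, MvPolynomial.monomial_sum_one,
    MvPolynomial.X_pow_eq_monomial]

lemma exists_expVec_eq (α : Fin n × ℕ →₀ ℕ) : ∃ f : Fin n → ℕ[X], expVec f = α := by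
  refine ⟨fun k => ∑ l ∈ Finset.range (α.support.sup Prod.snd + 1),
    Polynomial.monomial l (α (k, l)), ?_⟩
  ext ⟨k, l⟩
  rw [expVec_apply, Polynomial.finsetSum_coeff]
  simp only [Polynomial.coeff_monomial, Finset.sum_ite_eq', Finset.mem_range, ite_eq_left_iff]
  intro h
  by_contra h'
  exact h (Nat.lt_succ_of_le (Finset.le_sup (f := Prod.snd)
    (Finsupp.mem_support_iff.2 (Ne.symm h'))))

lemma varPow_eq_X (σK : K →+* K) (k : Fin n) (a : ℕ) :
    varPow σK k a = MvPolynomial.X (k, a) := by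
  rw [varPow, ypow, sexp, Finset.prod_eq_single a]
  · simp [iterate_shift_X]
  · intro b _ hb
    simp [Polynomial.coeff_X_pow, hb]
  · simp

/-- `p` is a prime σ-ideal containing `I`, and `y_k^{x^l} ∈ p` exactly when `c k ≤ l`. -/
structure IsPrimeOfPattern (σK : K →+* K) (I : Ideal (DPoly K n)) (c : Fin n → ℕ∞)
    (p : Ideal (DPoly K n)) : Prop where
  isPrime : p.IsPrime
  isSigmaIdeal : IsSigmaIdeal (shift σK) p
  le : I ≤ p
  X_mem_iff : ∀ k l, (MvPolynomial.X (k, l) : DPoly K n) ∈ p ↔ c k ≤ l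

lemma exists_isPrimeOfPattern {σK : K →+* K} {I p : Ideal (DPoly K n)} (hp : p.IsPrime)
    (hσ : IsSigmaIdeal (shift σK) p) (hI : I ≤ p) : ∃ c, IsPrimeOfPattern σK I c p := by
  have hmono : ∀ k l j, (MvPolynomial.X (k, l) : DPoly K n) ∈ p →
      (MvPolynomial.X (k, l + j) : DPoly K n) ∈ p := by
    intro k l j h
    induction j with
    | zero => exact h
    | succ j ih => simpa [shift, add_assoc] using hσ _ ih
  refine ⟨fun k => ⨅ l ∈ {l : ℕ | (MvPolynomial.X (k, l) : DPoly K n) ∈ p}, (l : ℕ∞),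
    hp, hσ, hI, fun k l => ⟨fun h => iInf₂_le l h, fun h => ?_⟩⟩
  by_contra hn
  have : ((l + 1 : ℕ) : ℕ∞) ≤
      ⨅ l ∈ {l : ℕ | (MvPolynomial.X (k, l) : DPoly K n) ∈ p}, (l : ℕ∞) := by
    refine le_iInf₂ fun l' hl' => Nat.cast_le.2 ?_
    by_contra! hlt
    obtain ⟨j, rfl⟩ := Nat.exists_eq_add_of_le (Nat.le_of_lt_succ hlt)
    exact hn (hmono k l' j hl')
  have := Nat.cast_le.1 (this.trans h)
  omega

variable {σK : K →+* K} {I p : Ideal (DPoly K n)} {c : Fin n → ℕ∞}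

lemma IsPrimeOfPattern.mono_mem_iff (hp : IsPrimeOfPattern σK I c p) (α : Fin n × ℕ →₀ ℕ) :
    mono K α ∈ p ↔ ¬ InBounds c α := by
  have := hp.isPrime
  rw [mono, MvPolynomial.monomial_eq, MvPolynomial.C_1, one_mul, Finsupp.prod,
    hp.isPrime.prod_mem_iff]
  simp only [InBounds, not_forall, not_lt]
  constructor
  · rintro ⟨⟨k, l⟩, hi, h⟩
    exact ⟨k, l, Finsupp.mem_support_iff.1 hi,
      (hp.X_mem_iff k l).1 (hp.isPrime.mem_of_pow_mem _ h)⟩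
  · rintro ⟨k, l, hα, h⟩
    exact ⟨(k, l), Finsupp.mem_support_iff.2 hα,
      Ideal.pow_mem_of_mem _ ((hp.X_mem_iff k l).2 h) _ (Nat.pos_of_ne_zero hα)⟩

/-- The congruence on exponent vectors defined by the pure binomials of an ideal. -/
def idealCon (p : Ideal (DPoly K n)) : AddCon (Fin n × ℕ →₀ ℕ) where
  r α β := mono K α - mono K β ∈ p
  iseqv := ⟨fun α => by simp, fun h => by simpa using p.neg_mem h,
    fun h h' => by simpa using p.add_mem h h'⟩
  add' {α β γ δ} h h' := by
    have : mono K (α + γ) - mono K (β + δ) =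
        mono K γ * (mono K α - mono K β) + mono K β * (mono K γ - mono K δ) := by
      rw [mono_add, mono_add]; ring
    rw [this]
    exact p.add_mem (p.mul_mem_left _ h) (p.mul_mem_left _ h')

lemma idealCon_iff {p : Ideal (DPoly K n)} {α β : Fin n × ℕ →₀ ℕ} :
    idealCon p α β ↔ mono K α - mono K β ∈ p := Iff.rfl

/-- A congruence on exponent vectors is stable if it is shift-invariant and one may cancel
exponent vectors respecting the bounds `b`. -/
structure IsStableCon (b : Fin n → ℕ∞) (r : AddCon (Fin n × ℕ →₀ ℕ)) : Prop where
  map_shift : ∀ {α β}, r α β → r (expShift 1 α) (expShift 1 β)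
  cancel : ∀ {μ α β}, InBounds b μ → r (μ + α) (μ + β) → r α β

lemma IsPrimeOfPattern.isStableCon (hp : IsPrimeOfPattern σK I c p) :
    IsStableCon c (idealCon p) where
  map_shift {α β} h := by
    rw [idealCon_iff] at h ⊢
    rw [← shift_mono σK, ← shift_mono σK, ← map_sub]
    exact hp.isSigmaIdeal _ h
  cancel {μ α β} hμ h := by
    rw [idealCon_iff, mono_add, mono_add, ← mul_sub] at h
    exact (hp.isPrime.mem_or_mem h).resolve_left fun h' => (hp.mono_mem_iff μ).1 h' hμ

open Topology Filter in
/-- The congruence of the pure binomials which lie in all prime σ-ideals containing `I` with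
pattern close to `b`. -/
def nearCon (σK : K →+* K) (I : Ideal (DPoly K n)) (b : Fin n → ℕ∞) :
    AddCon (Fin n × ℕ →₀ ℕ) where
  r α β := ∀ᶠ c in 𝓝 b, ∀ p, IsPrimeOfPattern σK I c p → idealCon p α β
  iseqv := ⟨fun α => .of_forall fun _ p _ => (idealCon p).refl α,
    fun h => h.mono fun _ h p hp => (idealCon p).symm (h p hp),
    fun h h' => (h.and h').mono fun _ h p hp => (idealCon p).trans (h.1 p hp) (h.2 p hp)⟩
  add' h h' :=
    (h.and h').mono fun _ h p hp => (idealCon p).add (h.1 p hp) (h.2 p hp)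

open Topology Filter in
lemma nearCon_iff {b : Fin n → ℕ∞} {α β : Fin n × ℕ →₀ ℕ} : nearCon σK I b α β ↔
    ∀ᶠ c in 𝓝 b, ∀ p, IsPrimeOfPattern σK I c p → idealCon p α β := Iff.rfl

open Topology Filter in
lemma eventually_inBounds {M : Type*} [Zero M] {b : Fin n → ℕ∞} {v : Fin n × ℕ →₀ M}
    (h : InBounds b v) : ∀ᶠ c in 𝓝 b, InBounds c v := by
  have : ∀ᶠ c in 𝓝 b, ∀ x ∈ v.support, (x.2 : ℕ∞) < c x.1 := by
    rw [Filter.eventually_all_finset]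
    intro x hx
    exact (continuous_apply x.1).continuousAt.eventually_mem
      (Ioi_mem_nhds (h x.1 x.2 (Finsupp.mem_support_iff.1 hx)))
  exact this.mono fun c hc k l hkl => hc (k, l) (Finsupp.mem_support_iff.2 hkl)

open Topology Filter in
lemma eventually_eq_of_ne_top (b : Fin n → ℕ∞) : ∀ᶠ c in 𝓝 b, ∀ k, b k ≠ ⊤ → c k = b k := by
  rw [Filter.eventually_all]
  intro k
  by_cases hk : b k = ⊤
  · simp [hk]
  · exact ((continuous_apply k).continuousAt.eventually_mem
      ((ENat.isOpen_singleton hk).mem_nhds rfl)).mono fun c hc _ => hc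

open Topology Filter in
lemma isStableCon_nearCon (σK : K →+* K) (I : Ideal (DPoly K n)) (b : Fin n → ℕ∞) :
    IsStableCon b (nearCon σK I b) where
  map_shift h := (nearCon_iff.1 h).mono fun _ h p hp => hp.isStableCon.map_shift (h p hp)
  cancel hμ h := ((eventually_inBounds hμ).and (nearCon_iff.1 h)).mono fun _ h p hp =>
    hp.isStableCon.cancel h.1 (h.2 p hp)

end Monomials

section ConIdeal

variable {K : Type*} [Field K] {n : ℕ}

/-- The ideal generated by the pure binomials of a congruence. -/
noncomputable def conIdeal (K : Type*) [Field K] {n : ℕ} (r : AddCon (Fin n × ℕ →₀ ℕ)) :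
    Ideal (DPoly K n) :=
  Ideal.span {x | ∃ α β, r α β ∧ x = mono K α - mono K β}

variable {r : AddCon (Fin n × ℕ →₀ ℕ)}

lemma mem_conIdeal_iff (g : DPoly K n) :
    g ∈ conIdeal K r ↔ AddMonoidAlgebra.mapDomainRingHom K r.mk' g = 0 := by
  constructor
  · intro hg
    rw [← RingHom.mem_ker]
    refine (Ideal.span_le.2 ?_ : conIdeal K r ≤ _) hg
    rintro x ⟨α, β, h, rfl⟩
    rw [SetLike.mem_coe, RingHom.mem_ker, map_sub, sub_eq_zero]
    simp only [mono, ← MvPolynomial.single_eq_monomial, AddMonoidAlgebra.mapDomainRingHom_apply,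
      AddMonoidAlgebra.mapDomain_single]
    rw [show r.mk' α = r.mk' β from r.eq.2 h]
  · intro hg
    obtain ⟨out, hout⟩ := r.mk'_surjective.hasRightInverse
    have key : ∀ g : DPoly K n, g - AddMonoidAlgebra.mapDomain out
        (AddMonoidAlgebra.mapDomainRingHom K r.mk' g) ∈ conIdeal K r := by
      intro g
      induction g using MvPolynomial.induction_on' with
      | monomial α a =>
        have : r α (out (r.mk' α)) := r.eq.1 (hout (r.mk' α)).symm
        simp only [← MvPolynomial.single_eq_monomial, AddMonoidAlgebra.mapDomainRingHom_apply,
          AddMonoidAlgebra.mapDomain_single]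
        simp only [MvPolynomial.single_eq_monomial]
        have h := (conIdeal K r).mul_mem_left (MvPolynomial.C a)
          (Ideal.subset_span ⟨α, _, this, rfl⟩)
        simpa [mono, mul_sub, MvPolynomial.C_mul_monomial] using h
      | add p q hp hq =>
        rw [map_add, AddMonoidAlgebra.mapDomain_add, add_sub_add_comm]
        exact (conIdeal K r).add_mem hp hq
    simpa [hg] using key g

lemma mono_sub_mono_mem_conIdeal_iff {α β : Fin n × ℕ →₀ ℕ} :
    mono K α - mono K β ∈ conIdeal K r ↔ r α β := by
  rw [mem_conIdeal_iff, map_sub, sub_eq_zero]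
  simp only [mono, ← MvPolynomial.single_eq_monomial, AddMonoidAlgebra.mapDomainRingHom_apply,
    AddMonoidAlgebra.mapDomain_single]
  rw [AddMonoidAlgebra.single_left_inj one_ne_zero]
  exact r.eq

lemma IsStableCon.mem_conIdeal_of_mono_mul_mem {b : Fin n → ℕ∞} (hr : IsStableCon b r)
    {μ : Fin n × ℕ →₀ ℕ} (hμ : InBounds b μ) {g : DPoly K n}
    (h : mono K μ * g ∈ conIdeal K r) : g ∈ conIdeal K r := by
  rw [mem_conIdeal_iff] at h ⊢
  rw [map_mul] at h
  generalize AddMonoidAlgebra.mapDomainRingHom K r.mk' g = x at h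
  ext q
  have h1 := congrArg (fun y => y.coeff (r.mk' μ + q)) h
  simp only [mono, ← MvPolynomial.single_eq_monomial, AddMonoidAlgebra.mapDomainRingHom_apply,
    AddMonoidAlgebra.mapDomain_single] at h1
  rw [AddMonoidAlgebra.coeff_single_mul_eq_mul_coeff (m₂ := q)] at h1
  · simpa using h1
  · intro q' _
    refine ⟨fun hq => ?_, fun hq => by rw [hq]⟩
    induction q using AddCon.induction_on with | H α =>
    induction q' using AddCon.induction_on with | H β =>
    exact r.eq.2 (hr.cancel hμ (r.eq.1 hq))

lemma IsStableCon.isSigmaIdeal_conIdeal {b : Fin n → ℕ∞} (hr : IsStableCon b r)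
    (σK : K →+* K) : IsSigmaIdeal (shift σK) (conIdeal K r) := by
  intro x hx
  refine (Ideal.span_le.2 ?_ : conIdeal K r ≤ (conIdeal K r).comap (shift σK)) hx
  rintro x ⟨α, β, h, rfl⟩
  rw [SetLike.mem_coe, Ideal.mem_comap, map_sub, shift_mono, shift_mono,
    mono_sub_mono_mem_conIdeal_iff]
  exact hr.map_shift h

lemma IsStableCon.isPureBinomialSigmaIdeal_conIdeal {b : Fin n → ℕ∞} (hr : IsStableCon b r)
    (σK : K →+* K) : IsPureBinomialSigmaIdeal σK (conIdeal K r) := by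
  refine ⟨{x | ∃ α β, r α β ∧ x = mono K α - mono K β}, ?_, le_antisymm ?_ ?_⟩
  · rintro x ⟨α, β, -, rfl⟩
    obtain ⟨f, rfl⟩ := exists_expVec_eq α
    obtain ⟨g, rfl⟩ := exists_expVec_eq β
    exact ⟨f, g, by rw [monom_eq_mono, monom_eq_mono]⟩
  · exact le_sInf fun J hJ => Ideal.span_le.2 hJ.1
  · exact sInf_le ⟨Ideal.subset_span, hr.isSigmaIdeal_conIdeal σK⟩

lemma le_conIdeal_nearCon {σK : K →+* K} {I : Ideal (DPoly K n)}
    (hI : IsPureBinomialSigmaIdeal σK I) (b : Fin n → ℕ∞) :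
    I ≤ conIdeal K (nearCon σK I b) := by
  obtain ⟨S, hS, hIS⟩ := hI
  have hSI : S ⊆ I := by
    rw [hIS]
    exact fun x hx => Submodule.mem_sInf.2 fun J hJ => hJ.1 hx
  conv_lhs => rw [hIS]
  refine sInf_le ⟨fun x hx => ?_, (isStableCon_nearCon σK I b).isSigmaIdeal_conIdeal σK⟩
  obtain ⟨f, g, rfl⟩ := hS x hx
  have hx' := hSI hx
  rw [SetLike.mem_coe, monom_eq_mono, monom_eq_mono] at *
  rw [mono_sub_mono_mem_conIdeal_iff]
  exact nearCon_iff.2 (.of_forall fun c p hp => hp.le hx')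

end ConIdeal

section DiffGroup

variable {n : ℕ} {b c : Fin n → ℕ∞} {r : AddCon (Fin n × ℕ →₀ ℕ)}

/-- The differences `α - β` of congruent exponent vectors respecting the bounds `b`. -/
def diffGroup (r : AddCon (Fin n × ℕ →₀ ℕ)) (b : Fin n → ℕ∞) :
    AddSubgroup (Fin n × ℕ →₀ ℤ) where
  carrier := {v | ∃ α β, InBounds b α ∧ InBounds b β ∧ r α β ∧ ∀ x, v x = α x - β x}
  zero_mem' := ⟨0, 0, by simp [InBounds], by simp [InBounds], r.refl 0, by simp⟩
  add_mem' := by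
    rintro v w ⟨α, β, hα, hβ, h, hv⟩ ⟨γ, δ, hγ, hδ, h', hw⟩
    refine ⟨α + γ, β + δ, fun k l hkl => ?_, fun k l hkl => ?_, r.add h h', fun x => ?_⟩
    · by_cases h0 : α (k, l) = 0
      · exact hγ k l (by simpa [h0] using hkl)
      · exact hα k l h0
    · by_cases h0 : β (k, l) = 0
      · exact hδ k l (by simpa [h0] using hkl)
      · exact hβ k l h0
    · simp [hv, hw]; ring
  neg_mem' := by
    rintro v ⟨α, β, hα, hβ, h, hv⟩
    exact ⟨β, α, hβ, hα, r.symm h, fun x => by simp [hv]⟩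

/-- The positive part of an integral exponent vector. -/
noncomputable def intPos (v : Fin n × ℕ →₀ ℤ) : Fin n × ℕ →₀ ℕ := v.mapRange Int.toNat rfl

@[simp] lemma intPos_apply (v : Fin n × ℕ →₀ ℤ) (x : Fin n × ℕ) :
    intPos v x = (v x).toNat := Finsupp.mapRange_apply

lemma InBounds.intPos {v : Fin n × ℕ →₀ ℤ} (h : InBounds b v) : InBounds b (intPos v) :=
  fun k l hkl => h k l fun h0 => hkl (by simp [h0])

lemma InBounds.neg {v : Fin n × ℕ →₀ ℤ} (h : InBounds b v) : InBounds b (-v) :=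
  fun k l hkl => h k l (by simpa using hkl)

lemma InBounds.add {v w : Fin n × ℕ →₀ ℤ} (h : InBounds b v) (h' : InBounds b w) :
    InBounds b (v + w) := fun k l hkl => by
  by_cases h0 : v (k, l) = 0
  · exact h' k l (by simpa [h0] using hkl)
  · exact h k l h0

lemma inBounds_of_mem_diffGroup {v : Fin n × ℕ →₀ ℤ} (hv : v ∈ diffGroup r b) :
    InBounds b v := by
  obtain ⟨α, β, hα, hβ, -, h⟩ := hv
  intro k l hkl
  by_cases h0 : α (k, l) = 0
  · refine hβ k l fun h1 => hkl ?_
    simp [h, h0, h1]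
  · exact hα k l h0

lemma IsStableCon.rel_of_sub_mem_diffGroup (hr : IsStableCon b r) {v : Fin n × ℕ →₀ ℤ}
    (hv : v ∈ diffGroup r b) {α β : Fin n × ℕ →₀ ℕ} (h : ∀ x, v x = α x - β x) : r α β := by
  obtain ⟨α', β', hα', hβ', h', hv'⟩ := hv
  refine hr.cancel hβ' ?_
  have : β' + α = α' + β := by
    ext x
    have h1 := h x
    have h2 := hv' x
    simp only [Finsupp.add_apply]
    omega
  rw [this]
  exact r.add h' (r.refl β)

lemma IsStableCon.rel_intPos (hr : IsStableCon b r) {v : Fin n × ℕ →₀ ℤ}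
    (hv : v ∈ diffGroup r b) : r (intPos v) (intPos (-v)) :=
  hr.rel_of_sub_mem_diffGroup hv fun x => by simp

lemma IsStableCon.iterate_shift (hr : IsStableCon b r) {α β : Fin n × ℕ →₀ ℕ} (h : r α β)
    (j : ℕ) : r (expShift j α) (expShift j β) := by
  induction j with
  | zero => simpa
  | succ j ih => simpa only [expShift_expShift] using hr.map_shift ih

lemma expShift_intPos (j : ℕ) (v : Fin n × ℕ →₀ ℤ) :
    expShift j (intPos v) = intPos (expShift j v) := by
  ext ⟨k, l⟩
  rcases lt_or_ge l j with hl | hl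
  · simp [expShift_apply_of_lt _ _ hl]
  · obtain ⟨l', rfl⟩ := Nat.exists_eq_add_of_le' hl
    simp

lemma IsStableCon.expShift_mem_diffGroup (hr : IsStableCon b r) {v : Fin n × ℕ →₀ ℤ}
    (hv : r (intPos v) (intPos (-v))) {j : ℕ} (hb : InBounds b (expShift j v)) :
    expShift j v ∈ diffGroup r b := by
  refine ⟨intPos (expShift j v), intPos (-expShift j v), hb.intPos, hb.neg.intPos, ?_,
    fun x => by simp⟩
  have := hr.iterate_shift hv j
  rwa [expShift_intPos, expShift_intPos, map_neg] at this

/-- The elements of `diffGroup r b` supported on the unbounded coordinates. -/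
noncomputable def freeDiffGroup (r : AddCon (Fin n × ℕ →₀ ℕ)) (b : Fin n → ℕ∞) :
    AddSubgroup (Fin n × ℕ →₀ ℤ) :=
  diffGroup r b ⊓
    { carrier := {v | ∀ k l, b k ≠ ⊤ → v (k, l) = 0}
      zero_mem' := by simp
      add_mem' := fun h h' k l hk => by simp [h k l hk, h' k l hk]
      neg_mem' := fun h k l hk => by simp [h k l hk] }

lemma mem_freeDiffGroup {v : Fin n × ℕ →₀ ℤ} : v ∈ freeDiffGroup r b ↔
    v ∈ diffGroup r b ∧ ∀ k l, b k ≠ ⊤ → v (k, l) = 0 := Iff.rfl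

lemma IsStableCon.expShift_mem_freeDiffGroup (hr : IsStableCon b r) {v : Fin n × ℕ →₀ ℤ}
    (hv : v ∈ freeDiffGroup r b) : expShift 1 v ∈ freeDiffGroup r b := by
  rw [mem_freeDiffGroup] at hv ⊢
  have h0 : ∀ k l, b k ≠ ⊤ → expShift 1 v (k, l) = 0 := by
    intro k l hk
    by_contra h
    obtain ⟨l', rfl, h'⟩ := exists_of_expShift_ne_zero h
    exact h' (hv.2 k l' hk)
  refine ⟨hr.expShift_mem_diffGroup (hr.rel_intPos hv.1) fun k l hkl => ?_, h0⟩
  by_cases hk : b k = ⊤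
  · simp [hk]
  · exact absurd (h0 k l hk) hkl

lemma exists_finite_closure_add_freeDiffGroup (r : AddCon (Fin n × ℕ →₀ ℕ)) (b : Fin n → ℕ∞) :
    ∃ W : Set (Fin n × ℕ →₀ ℤ), W.Finite ∧ W ⊆ diffGroup r b ∧
      ∀ v ∈ diffGroup r b, ∃ w ∈ AddSubgroup.closure W, v - w ∈ freeDiffGroup r b := by
  classical
  set B := Finset.univ.sup fun k => (b k).toNat with hB
  let φ : (Fin n × ℕ →₀ ℤ) →ₗ[ℤ] (Fin n × Fin B → ℤ) :=
    { toFun := fun v x => if b x.1 = ⊤ then 0 else v (x.1, x.2)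
      map_add' := fun v w => by ext x; by_cases h : b x.1 = ⊤ <;> simp [h]
      map_smul' := fun m v => by ext x; by_cases h : b x.1 = ⊤ <;> simp [h] }
  obtain ⟨t, ht⟩ := IsNoetherian.noetherian ((AddSubgroup.toIntSubmodule (diffGroup r b)).map φ)
  have hpre : ∀ y : t, ∃ v ∈ diffGroup r b, φ v = y := fun y => by
    have : (y : Fin n × Fin B → ℤ) ∈ (AddSubgroup.toIntSubmodule (diffGroup r b)).map φ := by
      rw [← ht]; exact Submodule.subset_span y.2
    obtain ⟨v, hv, h⟩ := this
    exact ⟨v, hv, h⟩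
  choose g hg hφg using hpre
  have hW : Set.range g ⊆ diffGroup r b := by
    rintro _ ⟨y, rfl⟩
    exact hg y
  refine ⟨Set.range g, Set.finite_range g, hW, fun v hv => ?_⟩
  have hle : Submodule.span ℤ (t : Set (Fin n × Fin B → ℤ)) ≤
      (AddSubgroup.toIntSubmodule (AddSubgroup.closure (Set.range g))).map φ :=
    Submodule.span_le.2 fun y hy => ⟨g ⟨y, hy⟩, AddSubgroup.subset_closure ⟨_, rfl⟩, hφg _⟩
  rw [ht] at hle
  obtain ⟨w, hw, hwv⟩ := hle ⟨v, hv, rfl⟩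
  have hw' : w ∈ AddSubgroup.closure (Set.range g) := hw
  have hmem : v - w ∈ diffGroup r b := sub_mem hv ((AddSubgroup.closure_le _).2 hW hw')
  refine ⟨w, hw', mem_freeDiffGroup.2 ⟨hmem, fun k l hk => ?_⟩⟩
  by_contra hne
  have hl := inBounds_of_mem_diffGroup hmem k l hne
  have hlB : l < B := by
    rw [← ENat.natCast_toNat hk, Nat.cast_lt] at hl
    exact hl.trans_le (Finset.le_sup (f := fun k => (b k).toNat) (Finset.mem_univ k))
  have := congrFun hwv (k, ⟨l, hlB⟩)
  simp only [φ, LinearMap.coe_mk, AddHom.coe_mk, hk, if_false] at this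
  simp [this] at hne

end DiffGroup

section Transfer

variable {n : ℕ} {b c : Fin n → ℕ∞} {r : AddCon (Fin n × ℕ →₀ ℕ)}
  {L L₀ : AddSubgroup (Fin n × ℕ →₀ ℤ)} {G W : Set (Fin n × ℕ →₀ ℤ)}

lemma InBounds.sub {v w : Fin n × ℕ →₀ ℤ} (h : InBounds b v) (h' : InBounds b w) :
    InBounds b (v - w) := by
  rw [sub_eq_add_neg]
  exact h.add h'.neg

lemma InBounds.mono {M : Type*} [Zero M] {v : Fin n × ℕ →₀ M} (h : InBounds c v) (hc : c ≤ b) :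
    InBounds b v := fun k l hkl => (h k l hkl).trans_le (hc k)

lemma inBounds_of_mem_closure (hW : ∀ w ∈ W, InBounds c w) {w : Fin n × ℕ →₀ ℤ}
    (hw : w ∈ AddSubgroup.closure W) : InBounds c w := by
  induction hw using AddSubgroup.closure_induction with
  | mem w hw => exact hW w hw
  | zero => simp [InBounds]
  | add v w _ _ hv hw => exact hv.add hw
  | neg v _ hv => exact hv.neg

lemma boundedSpan_le_diffGroup (hr : IsStableCon c r)
    (hG : ∀ g ∈ G, r (intPos g) (intPos (-g))) : boundedSpan G c ≤ diffGroup r c := by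
  refine (AddSubgroup.closure_le _).2 ?_
  rintro _ ⟨g, hg, j, rfl, hb⟩
  exact hr.expShift_mem_diffGroup (hG g hg) hb

lemma exists_inBounds_sub_expShift (hL₀ : ∀ v ∈ L₀, expShift 1 v ∈ L₀) (hGL : G ⊆ L₀)
    (hG : ∀ g ∈ G, InBounds c g) {s : ℕ} {v : Fin n × ℕ →₀ ℤ}
    (hv : v ∈ boundedSpan G fun k => c k + (s + 1 : ℕ)) :
    ∃ z ∈ L₀, InBounds c z ∧ InBounds (fun k => c k + s) (v - expShift (s + 1) z) := by
  induction hv using AddSubgroup.closure_induction with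
  | mem w hw =>
    obtain ⟨g, hg, j, rfl, hb⟩ := hw
    rcases le_or_gt (s + 1) j with hj | hj
    · obtain ⟨i, rfl⟩ := Nat.exists_eq_add_of_le' hj
      refine ⟨expShift i g, expShift_mem hL₀ i (hGL hg), fun k l hkl => ?_, ?_⟩
      · have := hb k (l + (s + 1)) (by rwa [← expShift_expShift, expShift_apply_add])
        rw [Nat.cast_add] at this
        exact lt_of_add_lt_add_right this
      · rw [expShift_expShift, sub_self]
        simp [InBounds]
    · refine ⟨0, zero_mem _, by simp [InBounds], fun k l hkl => ?_⟩
      rw [map_zero, sub_zero] at hkl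
      obtain ⟨l', rfl, h'⟩ := exists_of_expShift_ne_zero hkl
      rw [Nat.cast_add]
      refine ((ENat.add_lt_add_iff_right (ENat.natCast_ne_top j)).2 (hG g hg k l' h')).trans_le ?_
      exact add_le_add_right (Nat.cast_le.2 (Nat.le_of_lt_succ hj)) (c k)
  | zero => exact ⟨0, zero_mem _, by simp [InBounds], by simp [InBounds]⟩
  | add v w _ _ hv hw =>
    obtain ⟨z, hz, hzc, h⟩ := hv
    obtain ⟨z', hz', hzc', h'⟩ := hw
    refine ⟨z + z', add_mem hz hz', hzc.add hzc', ?_⟩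
    rw [map_add, add_sub_add_comm]
    exact h.add h'
  | neg v _ hv =>
    obtain ⟨z, hz, hzc, h⟩ := hv
    refine ⟨-z, neg_mem hz, hzc.neg, ?_⟩
    rw [map_neg, neg_sub_neg, ← neg_sub]
    exact h.neg

/-- The bounds `c ≤ b` are large enough for the differences in `G` and `W`, which generate `L`,
and these differences come from relations of the congruence `r`. -/
structure IsTruncation (b c : Fin n → ℕ∞) (r : AddCon (Fin n × ℕ →₀ ℕ))
    (L L₀ : AddSubgroup (Fin n × ℕ →₀ ℤ)) (G W : Set (Fin n × ℕ →₀ ℤ)) : Prop where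
  isStableCon : IsStableCon c r
  inBounds_iff : ∀ {α β}, r α β → (InBounds c α ↔ InBounds c β)
  le : c ≤ b
  eq_of_ne_top : ∀ k, b k ≠ ⊤ → c k = b k
  map_shift : ∀ v ∈ L₀, expShift 1 v ∈ L₀
  le_L : L₀ ≤ L
  subset : G ⊆ L₀
  mem_boundedSpan : ∀ c : Fin n → ℕ∞, ∀ v ∈ L₀, InBounds c v → v ∈ boundedSpan G c
  inBounds_G : ∀ g ∈ G, InBounds c g
  rel_G : ∀ g ∈ G, r (intPos g) (intPos (-g))
  inBounds_W : ∀ w ∈ W, InBounds c w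
  rel_W : ∀ w ∈ W, r (intPos w) (intPos (-w))
  exists_sub_mem : ∀ v ∈ L, ∃ w ∈ AddSubgroup.closure W, v - w ∈ L₀

namespace IsTruncation

lemma mem_diffGroup (h : IsTruncation b c r L L₀ G W) {v : Fin n × ℕ →₀ ℤ} (hv : v ∈ L)
    (hc : InBounds c v) : v ∈ diffGroup r c := by
  obtain ⟨w, hw, hvw⟩ := h.exists_sub_mem v hv
  have hwd : w ∈ diffGroup r c := by
    refine (AddSubgroup.closure_le _).2 (fun w hw => ?_) hw
    simpa using h.isStableCon.expShift_mem_diffGroup (j := 0) (h.rel_W w hw)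
      (by simpa using h.inBounds_W w hw)
  have := boundedSpan_le_diffGroup h.isStableCon h.rel_G
    (h.mem_boundedSpan c _ hvw (hc.sub (inBounds_of_mem_closure h.inBounds_W hw)))
  simpa using add_mem this hwd

lemma inBounds_of_inBounds (h : IsTruncation b c r L L₀ G W) {v : Fin n × ℕ →₀ ℤ} (hv : v ∈ L)
    {α β : Fin n × ℕ →₀ ℕ} (hvαβ : ∀ x, v x = α x - β x) (hα : InBounds b α)
    (hβ : InBounds c β) : InBounds c α := by
  classical
  by_contra hαc
  have hex : ∃ s : ℕ, InBounds (fun k => c k + s) α := by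
    refine ⟨α.support.sup Prod.snd + 1, fun k l hkl => ?_⟩
    refine lt_of_lt_of_le (Nat.cast_lt.2 (Nat.lt_succ_of_le
      (Finset.le_sup (f := Prod.snd) (Finsupp.mem_support_iff.2 hkl)))) le_add_self
  obtain ⟨s, hs⟩ : ∃ s, Nat.find hex = s + 1 := by
    refine Nat.exists_eq_succ_of_ne_zero fun h0 => hαc ?_
    have := Nat.find_spec hex
    rw [h0] at this
    simpa using this
  have hαs : InBounds (fun k => c k + (s + 1 : ℕ)) α := hs ▸ Nat.find_spec hex
  have hαs' : ¬ InBounds (fun k => c k + s) α := Nat.find_min hex (by omega)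
  obtain ⟨w, hw, hvw⟩ := h.exists_sub_mem v hv
  have hwc := inBounds_of_mem_closure h.inBounds_W hw
  have hle : c ≤ fun k => c k + (s + 1 : ℕ) := fun k => le_self_add
  obtain ⟨z, hz, hzc, hzr⟩ := exists_inBounds_sub_expShift h.map_shift h.subset h.inBounds_G
    (h.mem_boundedSpan _ _ hvw (InBounds.sub (fun k l hkl => by
      by_cases h0 : α (k, l) = 0
      · exact hβ.mono hle k l fun h1 => hkl (by simp [hvαβ, h0, h1])
      · exact hαs k l h0) (hwc.mono hle)))
  have hzα' : ∀ k (d : ℕ), c k = d → expShift (s + 1) z (k, d + s) = α (k, d + s) := by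
    intro k d hk
    have h1 : (v - w - expShift (s + 1) z) (k, d + s) = 0 := by
      by_contra hne
      have : ((d + s : ℕ) : ℕ∞) < c k + s := hzr k _ hne
      simp [hk] at this
    have h2 : w (k, d + s) = 0 := by
      by_contra hne
      have := hwc k _ hne
      rw [hk, Nat.cast_lt] at this
      omega
    have h3 : β (k, d + s) = 0 := by
      by_contra hne
      have := hβ k _ hne
      rw [hk, Nat.cast_lt] at this
      omega
    simp only [Finsupp.sub_apply, hvαβ, h2, h3] at h1
    push_cast at h1
    linarith
  have hzα : ∀ k (l : ℕ), c k = (l + 1 : ℕ) → z (k, l) = α (k, l + 1 + s) := by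
    intro k l hk
    rw [← hzα' k _ hk, ← expShift_apply_add (s + 1) z k l, add_right_comm l 1 s, add_assoc]
  have hrel := h.isStableCon.map_shift
    (h.isStableCon.rel_intPos (h.mem_diffGroup (h.le_L hz) hzc))
  have hneg : InBounds c (expShift 1 (intPos (-z))) := by
    intro k l hkl
    obtain ⟨l, rfl, hl⟩ := exists_of_expShift_ne_zero hkl
    have hlz : z (k, l) < 0 := by
      by_contra! hge
      exact hl (by simpa using hge)
    have hlc := hzc k l hlz.ne
    refine lt_of_le_of_ne ?_ fun heq => ?_
    · rw [Nat.cast_add, Nat.cast_one]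
      exact Order.add_one_le_of_lt hlc
    · have := hzα k l heq.symm
      omega
  have hpos := (h.inBounds_iff hrel).2 hneg
  refine hαs' fun k l hkl => ?_
  have hlt : (l : ℕ∞) < c k + (s + 1 : ℕ) := hαs k l hkl
  by_contra! hge
  have hct : c k ≠ ⊤ := fun ht => by simp [ht] at hge
  have hbk : b k = ⊤ := by
    by_contra hbk
    have h1 := hα k l hkl
    rw [← h.eq_of_ne_top k hbk] at h1
    exact absurd (le_self_add.trans hge) h1.not_ge
  obtain ⟨d, hd⟩ := ENat.ne_top_iff_exists.1 hct
  rw [← hd, ← Nat.cast_add, Nat.cast_lt] at hlt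
  rw [← hd, ← Nat.cast_add, Nat.cast_le] at hge
  obtain rfl : l = d + s := by omega
  rcases d with _ | d
  · have h0 := hzα' k 0 hd.symm
    rw [expShift_apply_of_lt z k (by omega)] at h0
    exact hkl (by exact_mod_cast h0.symm)
  · have hne : expShift 1 (intPos z) (k, d + 1) ≠ 0 := by
      rw [expShift_apply_add, intPos_apply, hzα k d hd.symm]
      simpa using hkl
    have := hpos k _ hne
    rw [← hd] at this
    exact lt_irrefl _ this

end IsTruncation

end Transfer

section Assembly

variable {K : Type*} [Field K] {n : ℕ} {σK : K →+* K} {I p : Ideal (DPoly K n)}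
  {b c : Fin n → ℕ∞}

lemma IsPrimeOfPattern.inBounds_iff (hp : IsPrimeOfPattern σK I c p) {α β : Fin n × ℕ →₀ ℕ}
    (h : idealCon p α β) : InBounds c α ↔ InBounds c β := by
  rw [idealCon_iff] at h
  rw [← not_iff_not, ← hp.mono_mem_iff, ← hp.mono_mem_iff]
  exact ⟨fun h' => by simpa using p.sub_mem h' h, fun h' => by simpa using p.add_mem h h'⟩

open Topology Filter in
lemma eventually_isTruncation (σK : K →+* K) (I : Ideal (DPoly K n)) (b : Fin n → ℕ∞) :
    ∃ L₀ G W, ∀ᶠ c in 𝓝 b, ∀ p, IsPrimeOfPattern σK I c p →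
      IsTruncation b c (idealCon p) (diffGroup (nearCon σK I b) b) L₀ G W := by
  have hr := isStableCon_nearCon σK I b
  have hsh : ∀ v ∈ freeDiffGroup (nearCon σK I b) b,
      expShift 1 v ∈ freeDiffGroup (nearCon σK I b) b :=
    fun v hv => hr.expShift_mem_freeDiffGroup hv
  obtain ⟨G, hGfin, hGL, hG⟩ := exists_finite_boundedSpan hsh
  obtain ⟨W, hWfin, hWL, hW⟩ := exists_finite_closure_add_freeDiffGroup (nearCon σK I b) b
  have hev : ∀ v ∈ G ∪ W, ∀ᶠ c in 𝓝 b, InBounds c v ∧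
      ∀ p, IsPrimeOfPattern σK I c p → idealCon p (intPos v) (intPos (-v)) := by
    intro v hv
    have hvL : v ∈ diffGroup (nearCon σK I b) b := by
      rcases hv with hv | hv
      exacts [(mem_freeDiffGroup.1 (hGL hv)).1, hWL hv]
    exact (eventually_inBounds (inBounds_of_mem_diffGroup hvL)).and
      (nearCon_iff.1 (hr.rel_intPos hvL))
  refine ⟨freeDiffGroup (nearCon σK I b) b, G, W, ?_⟩
  filter_upwards [(hGfin.union hWfin).eventually_all.2 hev, eventually_eq_of_ne_top b]
    with c hc hcb p hp
  exact
    { isStableCon := hp.isStableCon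
      inBounds_iff := hp.inBounds_iff
      le := fun k => by
        by_cases hk : b k = ⊤
        · simp [hk]
        · exact (hcb k hk).le
      eq_of_ne_top := hcb
      map_shift := hsh
      le_L := inf_le_left
      subset := hGL
      mem_boundedSpan := hG
      inBounds_G := fun g hg => (hc g (.inl hg)).1
      rel_G := fun g hg => (hc g (.inl hg)).2 p hp
      inBounds_W := fun w hw => (hc w (.inr hw)).1
      rel_W := fun w hw => (hc w (.inr hw)).2 p hp
      exists_sub_mem := hW }

/-- The pure binomials near `b` do not mix exponent vectors inside and outside the bounds `b`. -/
def IsCoherent (σK : K →+* K) (I : Ideal (DPoly K n)) (b : Fin n → ℕ∞) : Prop :=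
  ∀ α β, nearCon σK I b α β → (InBounds b α ↔ InBounds b β)

open Topology Filter in
lemma IsCoherent.eventually_conIdeal_le (h : IsCoherent σK I b) :
    ∀ᶠ c in 𝓝 b, ∀ p, IsPrimeOfPattern σK I c p → conIdeal K (nearCon σK I b) ≤ p := by
  obtain ⟨L₀, G, W, hT⟩ := eventually_isTruncation σK I b
  filter_upwards [hT] with c hc p hp
  have hT := hc p hp
  refine Ideal.span_le.2 ?_
  rintro _ ⟨α, β, hαβ, rfl⟩
  have hout : ¬ InBounds c α → ¬ InBounds c β → mono K α - mono K β ∈ p := fun h1 h2 =>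
    p.sub_mem ((hp.mono_mem_iff α).2 h1) ((hp.mono_mem_iff β).2 h2)
  by_cases hα : InBounds b α
  · have hβ := (h α β hαβ).1 hα
    set v : Fin n × ℕ →₀ ℤ :=
      α.mapRange Nat.cast Nat.cast_zero - β.mapRange Nat.cast Nat.cast_zero with hv
    have hvαβ : ∀ x, v x = α x - β x := fun x => by simp [hv]
    have hvL : v ∈ diffGroup (nearCon σK I b) b := ⟨α, β, hα, hβ, hαβ, hvαβ⟩
    have h1 := hT.inBounds_of_inBounds hvL hvαβ hα
    have h2 := hT.inBounds_of_inBounds (neg_mem hvL) (α := β) (β := α)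
      (fun x => by simp [hvαβ]) hβ
    by_cases hβc : InBounds c β
    · have hαc := h1 hβc
      refine hT.isStableCon.rel_of_sub_mem_diffGroup (hT.mem_diffGroup hvL fun k l hkl => ?_) hvαβ
      by_cases h0 : α (k, l) = 0
      · exact hβc k l fun h1 => hkl (by simp [hvαβ, h0, h1])
      · exact hαc k l h0
    · exact hout (fun hαc => hβc (h2 hαc)) hβc
  · exact hout (fun h' => hα (h'.mono hT.le)) fun h' => hα ((h α β hαβ).2 (h'.mono hT.le))

open Topology Filter in
lemma eventually_not_isPrimeOfPattern (h : ¬ IsCoherent σK I b) :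
    ∀ᶠ c in 𝓝 b, ∀ p, ¬ IsPrimeOfPattern σK I c p := by
  obtain ⟨α, β, hαβ, hα, hβ⟩ :
      ∃ α β, nearCon σK I b α β ∧ ¬ InBounds b α ∧ InBounds b β := by
    simp only [IsCoherent, not_forall, not_iff] at h
    obtain ⟨α, β, h, h'⟩ := h
    by_cases hα : InBounds b α
    · exact ⟨β, α, (nearCon σK I b).symm h, fun hβ => h'.2 hβ hα, hα⟩
    · exact ⟨α, β, h, hα, h'.1 hα⟩
  filter_upwards [nearCon_iff.1 hαβ, eventually_inBounds hβ, eventually_eq_of_ne_top b]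
    with c hc hβc hcb p hp
  have hαc := (hp.inBounds_iff (hc p hp)).2 hβc
  refine hα fun k l hkl => ?_
  by_cases hk : b k = ⊤
  · simp [hk]
  · exact hcb k hk ▸ hαc k l hkl

section Enumeration

variable {t : ℕ} {j : Fin t → Fin n} {d : Fin t → ℕ}

/-- `j` enumerates the coordinates where `b` is finite, and `d` lists the values of `b` there. -/
structure IsEnumeration (b : Fin n → ℕ∞) (j : Fin t → Fin n) (d : Fin t → ℕ) : Prop where
  injective : Function.Injective j
  exists_eq : ∀ k, b k ≠ ⊤ → ∃ m, j m = k
  apply_eq : ∀ m, b (j m) = d m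

lemma exists_isEnumeration (b : Fin n → ℕ∞) :
    ∃ (t : ℕ) (j : Fin t → Fin n) (d : Fin t → ℕ), IsEnumeration b j d := by
  classical
  let e := (Fintype.equivFin {k // b k ≠ ⊤}).symm
  refine ⟨_, fun m => e m, fun m => (b (e m)).toNat,
    Subtype.val_injective.comp e.injective, fun k hk => ⟨e.symm ⟨k, hk⟩, by simp⟩,
    fun m => (ENat.natCast_toNat (e m).2).symm⟩

lemma IsEnumeration.mono_mem_sigmaIdealGen_iff (h : IsEnumeration b j d) (σK : K →+* K)
    (α : Fin n × ℕ →₀ ℕ) :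
    mono K α ∈ sigmaIdealGen (shift σK) (varSet σK j d) ↔ ¬ InBounds b α := by
  have hspan : sigmaIdealGen (shift σK) (varSet σK j d) =
      Ideal.span (MvPolynomial.X '' {x : Fin n × ℕ | b x.1 ≤ x.2}) := by
    refine le_antisymm (sInf_le ⟨?_, ?_⟩) (le_sInf fun J hJ => Ideal.span_le.2 ?_)
    · rintro _ ⟨m, rfl⟩
      refine Ideal.subset_span ⟨(j m, d m), (h.apply_eq m).le, (varPow_eq_X σK _ _).symm⟩
    · intro x hx
      refine (Ideal.span_le.2 ?_ : Ideal.span _ ≤ (Ideal.span _).comap (shift σK)) hx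
      rintro _ ⟨⟨k, l⟩, hkl, rfl⟩
      refine Ideal.subset_span ⟨(k, l + 1), ?_, by simp [shift]⟩
      rw [Set.mem_ofPred_eq] at hkl ⊢
      exact hkl.trans (Nat.cast_le.2 l.le_succ)
    · rintro _ ⟨⟨k, l⟩, hkl, rfl⟩
      have hk : b k ≠ ⊤ := fun hk => by simp [hk] at hkl
      obtain ⟨m, rfl⟩ := h.exists_eq k hk
      rw [Set.mem_ofPred_eq, h.apply_eq, Nat.cast_le] at hkl
      obtain ⟨e, rfl⟩ := Nat.exists_eq_add_of_le hkl
      clear hkl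
      induction e with
      | zero => exact hJ.1 ⟨m, varPow_eq_X σK _ _⟩
      | succ e ih => simpa [shift, add_assoc] using hJ.2 _ ih
  classical
  rw [hspan, MvPolynomial.mem_ideal_span_X_image, MvPolynomial.support_monomial]
  simp [InBounds, and_comm]

lemma IsEnumeration.exists_of_mem_Tset (h : IsEnumeration b j d) {M : DPoly K n}
    (hM : M ∈ Tset σK j d) : ∃ μ, InBounds b μ ∧ M = mono K μ := by
  obtain ⟨f, hf, rfl⟩ := hM
  refine ⟨expVec f, fun k l hkl => ?_, monom_eq_mono σK f⟩
  by_cases hk : b k = ⊤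
  · simp [hk]
  obtain ⟨m, rfl⟩ := h.exists_eq k hk
  rw [h.apply_eq, Nat.cast_lt]
  by_contra! hle
  rw [expVec_apply] at hkl
  exact hkl (Polynomial.degree_lt_iff_coeff_zero _ _ |>.1 (hf m) l hle)

lemma IsEnumeration.quasiNormal (h : IsEnumeration b j d) (hco : IsCoherent σK I b) :
    QuasiNormal σK j d (conIdeal K (nearCon σK I b)) := by
  refine ⟨fun g M hM hg => ?_, fun f g hfg hf => ?_⟩
  · obtain ⟨μ, hμ, rfl⟩ := h.exists_of_mem_Tset hM
    exact (isStableCon_nearCon σK I b).mem_conIdeal_of_mono_mul_mem hμ hg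
  · simp only [monom_eq_mono, h.mono_mem_sigmaIdealGen_iff,
      mono_sub_mono_mem_conIdeal_iff] at hfg hf ⊢
    exact fun hg => hf ((hco _ _ hfg).2 hg)

lemma IsEnumeration.varSet_subset (h : IsEnumeration b j d) (hp : IsPrimeOfPattern σK I c p)
    (hc : ∀ k, b k ≠ ⊤ → c k = b k) : varSet σK j d ⊆ p := by
  rintro _ ⟨m, rfl⟩
  change varPow σK (j m) (d m) ∈ p
  rw [varPow_eq_X, hp.X_mem_iff, hc _ (by simp [h.apply_eq]), h.apply_eq]

end Enumeration

open Topology Filter in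
/-- Finitely many coherent bounds suffice to describe all prime σ-ideals containing
`I` and `y_i^{x^a}`. -/
lemma exists_finset_isCoherent (σK : K →+* K) (I : Ideal (DPoly K n)) (i : Fin n) (a : ℕ) :
    ∃ t : Finset (Fin n → ℕ∞), (∀ b ∈ t, b i ≤ a ∧ IsCoherent σK I b) ∧
      ∀ (c : Fin n → ℕ∞) p, c i ≤ a → IsPrimeOfPattern σK I c p → ∃ b ∈ t,
        conIdeal K (nearCon σK I b) ≤ p ∧ ∀ k, b k ≠ ⊤ → c k = b k := by
  classical
  have hcomp : IsCompact {c : Fin n → ℕ∞ | c i ≤ a} :=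
    (isClosed_Iic.preimage (continuous_apply i)).isCompact
  have hU : ∀ b : Fin n → ℕ∞, ∀ᶠ c in 𝓝 b, ∀ p, IsPrimeOfPattern σK I c p →
      IsCoherent σK I b ∧ conIdeal K (nearCon σK I b) ≤ p ∧ ∀ k, b k ≠ ⊤ → c k = b k := by
    intro b
    by_cases h : IsCoherent σK I b
    · filter_upwards [h.eventually_conIdeal_le, eventually_eq_of_ne_top b] with c hc hcb p hp
      exact ⟨h, hc p hp, hcb⟩
    · filter_upwards [eventually_not_isPrimeOfPattern h] with c hc p hp
      exact absurd hp (hc p)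
  obtain ⟨t, htC, ht⟩ := hcomp.elim_nhds_subcover _ fun b _ => hU b
  refine ⟨t.filter (IsCoherent σK I), fun b hb => ?_, fun c p hc hp => ?_⟩
  · rw [Finset.mem_filter] at hb
    exact ⟨htC b hb.1, hb.2⟩
  · obtain ⟨b, hb, hcU⟩ := Set.mem_iUnion₂.1 (ht hc)
    obtain ⟨h1, h2⟩ := hcU p hp
    exact ⟨b, Finset.mem_filter.2 ⟨hb, h1⟩, h2⟩

end Assembly

/-- `⟨I ∪ {y_i^{x^a}}⟩_r` is a finite intersection of ideals
`⟨J ∪ {y_{j_1}^{x^{b_{j_1}}},…}⟩_r` with `J ⊇ I` a pure binomial σ-ideal, `i` among the `j`'s,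
and each member either satisfying `J ⊆ [vars]` or being quasi-normal. -/
theorem stmt10 {K : Type*} [Field K] [CharZero K] {n : ℕ} (σK : K →+* K)
    (i : Fin n) (a : ℕ) (I : Ideal (DPoly K n)) (hI : IsPureBinomialSigmaIdeal σK I) :
    ∃ (l : ℕ) (t : Fin l → ℕ) (J : Fin l → Ideal (DPoly K n))
      (j : ∀ k : Fin l, Fin (t k) → Fin n) (b : ∀ k : Fin l, Fin (t k) → ℕ),
      (∀ k, Function.Injective (j k)) ∧
      (∀ k, IsPureBinomialSigmaIdeal σK (J k)) ∧
      (∀ k, I ≤ J k) ∧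
      (∀ k, ∃ m, j k m = i) ∧
      (∀ k, J k ≤ sigmaIdealGen (shift σK) (varSet σK (j k) (b k)) ∨
        QuasiNormal σK (j k) (b k) (J k)) ∧
      rwmClosure (shift σK) ((I : Set (DPoly K n)) ∪ {varPow σK i a}) =
        ⨅ k : Fin l, rwmClosure (shift σK)
          ((J k : Set (DPoly K n)) ∪ varSet σK (j k) (b k)) := by
  obtain ⟨T, hT, hcover⟩ := exists_finset_isCoherent σK I i a
  choose t j d hd using fun b : Fin n → ℕ∞ => exists_isEnumeration b
  have e := T.equivFin.symm
  have hi : ∀ b ∈ T, ∃ m, j b m = i := fun b hb =>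
    (hd b).exists_eq i ((hT b hb).1.trans_lt (ENat.natCast_lt_top a)).ne
  refine ⟨T.card, fun k => t (e k), fun k => conIdeal K (nearCon σK I (e k)),
    fun k => j (e k), fun k => d (e k), fun k => (hd _).injective,
    fun k => (isStableCon_nearCon σK I _).isPureBinomialSigmaIdeal_conIdeal σK,
    fun k => le_conIdeal_nearCon hI _, fun k => hi _ (e k).2,
    fun k => .inr ((hd _).quasiNormal (hT _ (e k).2).2), le_antisymm (le_iInf fun k => ?_) ?_⟩
  · intro f hf
    refine mem_rwmClosure_of_forall fun p hp hσ hF => rwmClosure_le_of_isPrime hp hσ ?_ hf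
    rw [Set.union_subset_iff] at hF ⊢
    obtain ⟨c, hc⟩ := exists_isPrimeOfPattern (I := I) hp hσ
      ((le_conIdeal_nearCon hI _).trans hF.1)
    refine ⟨hc.le, Set.singleton_subset_iff.2 ?_⟩
    obtain ⟨m, hm⟩ := hi _ (e k).2
    have hXm : varPow σK (j (e k) m) (d (e k) m) ∈ p := hF.2 ⟨m, rfl⟩
    have hle := (hT _ (e k).2).1
    rw [SetLike.mem_coe]
    rw [varPow_eq_X, hc.X_mem_iff] at hXm ⊢
    rw [← (hd _).apply_eq, hm] at hXm
    exact hXm.trans hle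
  · intro f hf
    refine mem_rwmClosure_of_forall fun p hp hσ hF => ?_
    rw [Set.union_subset_iff, Set.singleton_subset_iff] at hF
    obtain ⟨c, hc⟩ := exists_isPrimeOfPattern hp hσ hF.1
    have hci : c i ≤ a := by
      rw [← hc.X_mem_iff, ← varPow_eq_X σK]
      exact hF.2
    obtain ⟨b, hb, hbp, hcb⟩ := hcover c p hci hc
    obtain ⟨k, hk⟩ := e.surjective ⟨b, hb⟩
    obtain rfl : (e k : Fin n → ℕ∞) = b := by rw [hk]
    exact rwmClosure_le_of_isPrime hp hσ
      (Set.union_subset hbp ((hd _).varSet_subset hc hcb)) (Submodule.mem_iInf _ |>.1 hf k)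
end

section
/- Every strictly ascending chain I_1 ⊊ I_2 ⊊ I_3 ⊊ ⋯ of radical well-mixed σ-ideals of K{y_1,…,y_n}, each of which is the radical well-mixed closure of a set of pure binomials, is finite; equivalently, there is no infinite strictly increasing sequence of such ideals. -/
open Polynomial

/-- Translation of the second coordinate by `s`. -/
def bump {ι : Type*} (s : ℕ) (v : ι × ℕ) : ι × ℕ := (v.1, v.2 + s)

theorem bump_injective {ι : Type*} (s : ℕ) : Function.Injective (bump s : ι × ℕ → ι × ℕ) := by
  rintro ⟨i, j⟩ ⟨i', j'⟩ h
  simpa [bump] using h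

/-- Coercion of natural exponent vectors to integral ones. -/
noncomputable def toInt {α : Type*} : (α →₀ ℕ) →+ (α →₀ ℤ) :=
  Finsupp.mapRange.addMonoidHom (Nat.castAddMonoidHom ℤ)

@[simp]
theorem toInt_apply {α : Type*} (f : α →₀ ℕ) (v : α) : toInt f v = (f v : ℤ) := rfl

theorem toInt_injective {α : Type*} : Function.Injective (toInt : (α →₀ ℕ) → (α →₀ ℤ)) := by
  intro f g h
  ext v
  simpa using DFunLike.congr_fun h v

theorem toInt_mapDomain {α β : Type*} (e : α → β) (f : α →₀ ℕ) :
    toInt (f.mapDomain e) = (toInt f).mapDomain e := by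
  induction f using Finsupp.induction_linear with
  | zero => simp
  | add f g hf hg => simp [Finsupp.mapDomain_add, hf, hg]
  | single a b => simp [Finsupp.mapDomain_single, toInt]

theorem toInt_toNat_sub {α : Type*} (h : α →₀ ℤ) :
    toInt (h.mapRange Int.toNat rfl) - toInt ((-h).mapRange Int.toNat rfl) = h := by
  ext v
  simp only [Finsupp.sub_apply, toInt_apply, Finsupp.mapRange_apply, Finsupp.neg_apply]
  omega

/-- A variable `(i, j)` is alive if `j < life i`. The submodule `rel` consists of relations between
alive variables; when a relation is shifted, its positive and negative parts die together. -/
structure ShiftSystem (ι : Type*) where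
  life : ι → ℕ∞
  rel : Submodule ℤ (ι × ℕ →₀ ℤ)
  alive_of_mem : ∀ h ∈ rel, ∀ v, h v ≠ 0 → (v.2 : ℕ∞) < life v.1
  alive_bump_of_mem : ∀ h ∈ rel, ∀ s : ℕ,
    (∀ v, 0 < h v → ((bump s v).2 : ℕ∞) < life (bump s v).1) →
      ∀ v, h v ≠ 0 → ((bump s v).2 : ℕ∞) < life (bump s v).1
  bump_mem : ∀ h ∈ rel, ∀ s : ℕ,
    (∀ v, h v ≠ 0 → ((bump s v).2 : ℕ∞) < life (bump s v).1) → h.mapDomain (bump s) ∈ rel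

namespace ShiftSystem

open Filter

variable {ι : Type*}

/-- Integer-valued lifetimes, where infinite lifetimes are replaced by large integers. -/
structure IsClock (T : ℕ → ShiftSystem ι) (c : ℕ → ι → ℤ) : Prop where
  eq_of_life_eq : ∀ k i (a : ℕ), (T k).life i = a → c k i = a
  le_of_life_eq_top : ∀ k i, (T k).life i = ⊤ → (k : ℤ) ≤ c k i

/-- The remaining lifetime of a variable. -/
def rest (c : ℕ → ι → ℤ) (k : ℕ) (v : ι × ℕ) : ℤ := c k v.1 - v.2

theorem rest_bump (c : ℕ → ι → ℤ) (k s : ℕ) (v : ι × ℕ) :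
    rest c k (bump s v) = rest c k v - s := by
  simp only [rest, bump]; push_cast; ring

theorem IsClock.alive_of_rest_pos {T : ℕ → ShiftSystem ι} {c : ℕ → ι → ℤ} (hc : IsClock T c)
    {k : ℕ} {v : ι × ℕ} (h : 0 < rest c k v) : (v.2 : ℕ∞) < (T k).life v.1 := by
  rcases eq_or_ne ((T k).life v.1) ⊤ with ht | ht
  · rw [ht]; exact ENat.natCast_lt_top _
  · obtain ⟨a, ha⟩ := ENat.ne_top_iff_exists.mp ht
    have := hc.eq_of_life_eq k v.1 a ha.symm
    rw [← ha]
    simp only [rest] at h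
    exact_mod_cast (show v.2 < a by omega)

theorem IsClock.rest_pos_of_alive {T : ℕ → ShiftSystem ι} {c : ℕ → ι → ℤ} (hc : IsClock T c)
    {k : ℕ} {v : ι × ℕ} (h : (v.2 : ℕ∞) < (T k).life v.1) (hk : v.2 < k) :
    0 < rest c k v := by
  rcases eq_or_ne ((T k).life v.1) ⊤ with ht | ht
  · have := hc.le_of_life_eq_top k v.1 ht
    simp only [rest]; omega
  · obtain ⟨a, ha⟩ := ENat.ne_top_iff_exists.mp ht
    have := hc.eq_of_life_eq k v.1 a ha.symm
    rw [← ha] at h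
    have h' : v.2 < a := by exact_mod_cast h
    simp only [rest]; omega

theorem IsClock.rest_pos_of_alive_of_ne_top {T : ℕ → ShiftSystem ι} {c : ℕ → ι → ℤ}
    (hc : IsClock T c) {k : ℕ} {v : ι × ℕ} (h : (v.2 : ℕ∞) < (T k).life v.1)
    (ht : (T k).life v.1 ≠ ⊤) : 0 < rest c k v := by
  obtain ⟨a, ha⟩ := ENat.ne_top_iff_exists.mp ht
  have := hc.eq_of_life_eq k v.1 a ha.symm
  rw [← ha] at h
  have h' : v.2 < a := by exact_mod_cast h
  simp only [rest]; omega

/-- The remaining lifetime of a variable along the sequence, as an element of an ultrapower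
of `ℤ`. -/
noncomputable def limRest (c : ℕ → ι → ℤ) (v : ι × ℕ) : (hyperfilter ℕ : Filter ℕ).Germ ℤ :=
  ((fun k => rest c k v : ℕ → ℤ) : (hyperfilter ℕ : Filter ℕ).Germ ℤ)

theorem limRest_le {c : ℕ → ι → ℤ} {v w : ι × ℕ} :
    limRest c v ≤ limRest c w ↔ ∀ᶠ k in (hyperfilter ℕ : Filter ℕ), rest c k v ≤ rest c k w :=
  Germ.coe_le

theorem limRest_lt {c : ℕ → ι → ℤ} {v w : ι × ℕ} :
    limRest c v < limRest c w ↔ ∀ᶠ k in (hyperfilter ℕ : Filter ℕ), rest c k v < rest c k w :=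
  Germ.coe_lt

theorem limRest_eq {c : ℕ → ι → ℤ} {v w : ι × ℕ} :
    limRest c v = limRest c w ↔ ∀ᶠ k in (hyperfilter ℕ : Filter ℕ), rest c k v = rest c k w :=
  Germ.coe_eq

theorem limRest_bump_le {c : ℕ → ι → ℤ} {v w : ι × ℕ} (s : ℕ) :
    limRest c (bump s v) ≤ limRest c (bump s w) ↔ limRest c v ≤ limRest c w := by
  simp [limRest_le, rest_bump]

theorem limRest_bump_eq {c : ℕ → ι → ℤ} {v w : ι × ℕ} (s : ℕ) :
    limRest c (bump s v) = limRest c (bump s w) ↔ limRest c v = limRest c w := by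
  simp [limRest_eq, rest_bump]

theorem limRest_fst_injOn (c : ℕ → ι → ℤ) (v : ι × ℕ) :
    Set.InjOn Prod.fst {w | limRest c w = limRest c v} := by
  rintro ⟨i, j⟩ h ⟨i', j'⟩ h' (rfl : i = i')
  obtain ⟨k, hk⟩ := (limRest_eq.mp (h.trans h'.symm)).exists
  simp only [rest] at hk
  ext
  · rfl
  · simp only; omega

theorem wellFounded_limRest_gt [Finite ι] (c : ℕ → ι → ℤ) :
    WellFounded fun v w : ι × ℕ => limRest c w < limRest c v := by
  rw [wellFounded_iff_isEmpty_descending_chain]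
  refine ⟨fun ⟨f, hf⟩ => ?_⟩
  have hmono : StrictMono fun m => limRest c (f m) := strictMono_nat_of_lt_succ hf
  obtain ⟨m, k, hmk, h1, h2⟩ :=
    (Finite.wellQuasiOrdered (fun a b : ι => a = b)).prod
      (wellQuasiOrdered_le (α := ℕ)) f
  obtain ⟨l, hl⟩ := (limRest_lt.mp (hmono hmk)).exists
  simp only [rest, h1] at hl
  omega

theorem eventually_gt_hyperfilter (m : ℕ) : ∀ᶠ k in (hyperfilter ℕ : Filter ℕ), m < k :=
  Nat.hyperfilter_le_atTop (eventually_gt_atTop m)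

theorem eventually_eventually_le {α : Type*} [LinearOrder α] [WellFoundedLT α] (a : ℕ → α) :
    ∀ᶠ k in (hyperfilter ℕ : Filter ℕ), ∀ᶠ m in (hyperfilter ℕ : Filter ℕ), a k ≤ a m := by
  by_contra hcon
  rw [← Ultrafilter.eventually_not] at hcon
  have hne : {k | ¬ ∀ᶠ m in (hyperfilter ℕ : Filter ℕ), a k ≤ a m}.Nonempty := hcon.exists
  have hmin := Function.argminOn_mem a _ hne
  set k := Function.argminOn a _ hne
  have hk : ∀ᶠ m in (hyperfilter ℕ : Filter ℕ), ¬ a k ≤ a m :=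
    Ultrafilter.eventually_not.mpr hmin
  obtain ⟨m, hm, hm'⟩ := (hk.and hcon).exists
  exact hm (Function.argminOn_le a _ hm')

/-- The part of `h` supported on variables of limiting lifetime `q`, projected to `ι`. -/
noncomputable def lead (c : ℕ → ι → ℤ) (q : (hyperfilter ℕ : Filter ℕ).Germ ℤ) :
    (ι × ℕ →₀ ℤ) →ₗ[ℤ] (ι →₀ ℤ) :=
  open Classical in
  (Finsupp.lmapDomain ℤ ℤ Prod.fst).comp
    (Finsupp.filterAddHom (fun w => limRest c w = q)).toIntLinearMap

open Classical in
theorem lead_apply (c : ℕ → ι → ℤ) (q : (hyperfilter ℕ : Filter ℕ).Germ ℤ) (h : ι × ℕ →₀ ℤ) :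
    lead c q h = (h.filter fun w => limRest c w = q).mapDomain Prod.fst := rfl

theorem eq_zero_of_lead_eq_zero {c : ℕ → ι → ℤ} {v w : ι × ℕ} {h : ι × ℕ →₀ ℤ}
    (h0 : lead c (limRest c v) h = 0) (hw : limRest c w = limRest c v) : h w = 0 := by
  classical
  have : (h.filter fun w => limRest c w = limRest c v) = 0 := by
    refine Finsupp.mapDomain_injOn _ (limRest_fst_injOn c v) ?_ (by simp) ?_
    · intro x hx
      simp only [Finsupp.support_filter, Finset.coe_filter] at hx
      exact hx.2
    · rw [Finsupp.mapDomain_zero, ← h0, lead_apply]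
  have h2 := DFunLike.congr_fun this w
  rwa [Finsupp.filter_apply_pos (fun w => limRest c w = limRest c v) h hw] at h2

theorem lead_mapDomain_bump (c : ℕ → ι → ℤ) (v : ι × ℕ) (s : ℕ) (h : ι × ℕ →₀ ℤ) :
    lead c (limRest c (bump s v)) (h.mapDomain (bump s)) = lead c (limRest c v) h := by
  classical
  induction h using Finsupp.induction_linear with
  | zero => simp
  | add f g hf hg => rw [Finsupp.mapDomain_add, map_add, map_add, hf, hg]
  | single w a =>
    rw [Finsupp.mapDomain_single, lead_apply, lead_apply]
    by_cases hw : limRest c w = limRest c v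
    · rw [Finsupp.filter_single_of_pos (fun w => limRest c w = limRest c v) hw,
        Finsupp.filter_single_of_pos (fun w => limRest c w = limRest c (bump s v))
          ((limRest_bump_eq s).mpr hw)]
      simp [bump]
    · rw [Finsupp.filter_single_of_neg (fun w => limRest c w = limRest c v) hw,
        Finsupp.filter_single_of_neg (fun w => limRest c w = limRest c (bump s v))
          (fun h => hw ((limRest_bump_eq s).mp h))]

/-- The relations which hold in almost all terms of the sequence. -/
def limRel (T : ℕ → ShiftSystem ι) : Submodule ℤ (ι × ℕ →₀ ℤ) where
  carrier := {h | ∀ᶠ k in (hyperfilter ℕ : Filter ℕ), h ∈ (T k).rel}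
  add_mem' ha hb := by
    filter_upwards [ha, hb] with k ha hb using add_mem ha hb
  zero_mem' := Eventually.of_forall fun k => zero_mem _
  smul_mem' a h hh := by
    filter_upwards [hh] with k hh using Submodule.smul_mem _ a hh

/-- The finitely supported functions whose support has weight at least `a`. -/
def supportGe {α : Type*} [LinearOrder α] (f : ι × ℕ → α) (a : α) :
    Submodule ℤ (ι × ℕ →₀ ℤ) where
  carrier := {h | ∀ w, h w ≠ 0 → a ≤ f w}
  add_mem' {x y} hx hy w hw := by
    by_cases h : x w = 0
    · refine hy w fun h' => hw ?_
      simp [h, h']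
    · exact hx w h
  zero_mem' w hw := absurd rfl hw
  smul_mem' a h hh w hw := hh w fun h0 => hw (by simp [h0])

/-- Limiting relations whose support has limiting lifetime at least that of `v`. -/
noncomputable def limRelGe (T : ℕ → ShiftSystem ι) (c : ℕ → ι → ℤ) (v : ι × ℕ) :
    Submodule ℤ (ι × ℕ →₀ ℤ) :=
  limRel T ⊓ supportGe (limRest c) (limRest c v)

/-- The elements of `limRelGe` for which the defining conditions hold at stage `k`. -/
noncomputable def limRelGeAt (T : ℕ → ShiftSystem ι) (c : ℕ → ι → ℤ) (k : ℕ) (v : ι × ℕ) :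
    Submodule ℤ (ι × ℕ →₀ ℤ) :=
  limRelGe T c v ⊓ ((T k).rel ⊓ supportGe (rest c k) (rest c k v))

theorem eventually_mem_limRelGeAt {T : ℕ → ShiftSystem ι} {c : ℕ → ι → ℤ} {v : ι × ℕ}
    {h : ι × ℕ →₀ ℤ} (hh : h ∈ limRelGe T c v) :
    ∀ᶠ k in (hyperfilter ℕ : Filter ℕ), h ∈ limRelGeAt T c k v := by
  have h1 : ∀ᶠ k in (hyperfilter ℕ : Filter ℕ), ∀ w ∈ h.support, rest c k v ≤ rest c k w :=
    (Finset.eventually_all _).mpr fun w hw =>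
      limRest_le.mp (hh.2 w (Finsupp.mem_support_iff.mp hw))
  filter_upwards [hh.1, h1] with k hk1 hk2
  exact ⟨hh, hk1, fun w hw => hk2 w (Finsupp.mem_support_iff.mpr hw)⟩

theorem eventually_map_lead_le [Finite ι] (T : ℕ → ShiftSystem ι) (c : ℕ → ι → ℤ) (v : ι × ℕ) :
    ∀ᶠ k in (hyperfilter ℕ : Filter ℕ),
      (limRelGe T c v).map (lead c (limRest c v)) ≤
        (limRelGeAt T c k v).map (lead c (limRest c v)) := by
  obtain ⟨S, hS⟩ := IsNoetherian.noetherian ((limRelGe T c v).map (lead c (limRest c v)))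
  have : ∀ᶠ k in (hyperfilter ℕ : Filter ℕ), ∀ x ∈ S,
      x ∈ (limRelGeAt T c k v).map (lead c (limRest c v)) := by
    refine (Finset.eventually_all _).mpr fun x hx => ?_
    have hx' : x ∈ (limRelGe T c v).map (lead c (limRest c v)) := by
      rw [← hS]; exact Submodule.subset_span hx
    obtain ⟨h, hh, rfl⟩ := hx'
    filter_upwards [eventually_mem_limRelGeAt hh] with k hk
    exact Submodule.mem_map_of_mem hk
  filter_upwards [this] with k hk
  rw [← hS, Submodule.span_le]
  exact hk

theorem IsClock.eventually_rest_pos {T : ℕ → ShiftSystem ι} {c : ℕ → ι → ℤ} (hc : IsClock T c)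
    {v : ι × ℕ} (hv : ∀ᶠ k in (hyperfilter ℕ : Filter ℕ), (v.2 : ℕ∞) < (T k).life v.1) :
    ∀ᶠ k in (hyperfilter ℕ : Filter ℕ), 0 < rest c k v := by
  filter_upwards [hv, eventually_gt_hyperfilter v.2] with k hk hk'
  exact hc.rest_pos_of_alive hk hk'

theorem mapDomain_bump_ne_zero {s : ℕ} {h : ι × ℕ →₀ ℤ} {w : ι × ℕ}
    (hw : h.mapDomain (bump s) w ≠ 0) : ∃ v, h v ≠ 0 ∧ bump s v = w := by
  classical
  have := Finsupp.mapDomain_support (Finsupp.mem_support_iff.mpr hw)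
  simpa using this

theorem bump_mem_limRelGe {T : ℕ → ShiftSystem ι} {c : ℕ → ι → ℤ} (hc : IsClock T c)
    {v : ι × ℕ} {s : ℕ} {h : ι × ℕ →₀ ℤ} (hh : h ∈ limRelGe T c v)
    (hv : ∀ᶠ k in (hyperfilter ℕ : Filter ℕ), ((bump s v).2 : ℕ∞) < (T k).life (bump s v).1) :
    h.mapDomain (bump s) ∈ limRelGe T c (bump s v) := by
  refine ⟨?_, fun w hw => ?_⟩
  · filter_upwards [eventually_mem_limRelGeAt hh, hc.eventually_rest_pos hv] with k hk hpos
    refine (T k).bump_mem h hk.2.1 s fun w hw => hc.alive_of_rest_pos ?_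
    have := hk.2.2 w hw
    rw [rest_bump] at hpos ⊢
    omega
  · obtain ⟨u, hu, rfl⟩ := mapDomain_bump_ne_zero hw
    exact (limRest_bump_le s).mpr (hh.2 u hu)

theorem map_lead_limRelGe_mono {T : ℕ → ShiftSystem ι} {c : ℕ → ι → ℤ} (hc : IsClock T c)
    {v : ι × ℕ} {s : ℕ}
    (hv : ∀ᶠ k in (hyperfilter ℕ : Filter ℕ), ((bump s v).2 : ℕ∞) < (T k).life (bump s v).1) :
    (limRelGe T c v).map (lead c (limRest c v)) ≤
      (limRelGe T c (bump s v)).map (lead c (limRest c (bump s v))) := by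
  rintro _ ⟨h, hh, rfl⟩
  exact ⟨_, bump_mem_limRelGe hc hh hv, lead_mapDomain_bump c v s h⟩

theorem exists_map_lead_stable [Finite ι] {T : ℕ → ShiftSystem ι} {c : ℕ → ι → ℤ}
    (hc : IsClock T c) (i : ι) :
    ∃ d : ℕ, ∀ j, d ≤ j → (∀ᶠ k in (hyperfilter ℕ : Filter ℕ), (j : ℕ∞) < (T k).life i) →
      (limRelGe T c (i, j)).map (lead c (limRest c (i, j))) ≤
        (limRelGe T c (i, d)).map (lead c (limRest c (i, d))) := by
  set M : ℕ → Submodule ℤ (ι →₀ ℤ) :=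
    fun j => (limRelGe T c (i, j)).map (lead c (limRest c (i, j))) with hM
  set A : Set ℕ := {j | ∀ᶠ k in (hyperfilter ℕ : Filter ℕ), (j : ℕ∞) < (T k).life i} with hA
  rcases A.eq_empty_or_nonempty with hempty | hne
  · exact ⟨0, fun j _ hj => absurd (show j ∈ A from hj) (by simp [hempty])⟩
  obtain ⟨_, ⟨d, hd, rfl⟩, hmax⟩ :=
    WellFounded.has_min (wellFounded_gt (α := Submodule ℤ (ι →₀ ℤ))) (M '' A) (hne.image M)
  refine ⟨d, fun j hdj hj => ?_⟩
  have hmono : M d ≤ M j := by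
    have := map_lead_limRelGe_mono hc (v := (i, d)) (s := j - d)
      (by simpa [bump, Nat.add_sub_cancel' hdj] using hj)
    simpa [bump, Nat.add_sub_cancel' hdj] using this
  by_contra hnot
  exact hmax (M j) ⟨j, hj, rfl⟩ (lt_of_le_not_ge hmono hnot)

/-- At a suitable stage `k`, the limiting leading coefficients at `v` are attained by relations
that are alive at stage `k`. -/
theorem eventually_exists_reducer [Finite ι] {T : ℕ → ShiftSystem ι} {c : ℕ → ι → ℤ}
    (hc : IsClock T c) :
    ∀ᶠ k in (hyperfilter ℕ : Filter ℕ), ∀ v : ι × ℕ,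
      (∀ᶠ m in (hyperfilter ℕ : Filter ℕ), (v.2 : ℕ∞) < (T m).life v.1) → 0 < rest c k v →
      ∀ h ∈ limRelGe T c v, ∃ u ∈ limRelGeAt T c k v,
        lead c (limRest c v) u = lead c (limRest c v) h := by
  choose d hd using fun i => exists_map_lead_stable (T := T) hc i
  have h1 : ∀ᶠ k in (hyperfilter ℕ : Filter ℕ), ∀ i, ∀ j ∈ Finset.range (d i + 1),
      (limRelGe T c (i, j)).map (lead c (limRest c (i, j))) ≤
        (limRelGeAt T c k (i, j)).map (lead c (limRest c (i, j))) :=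
    eventually_all.mpr fun i => (Finset.eventually_all _).mpr fun j _ =>
      eventually_map_lead_le T c (i, j)
  filter_upwards [h1] with k hk
  rintro ⟨i, j⟩ halive hpos h hh
  rcases le_total j (d i) with hj | hj
  · exact hk i j (by simpa [Nat.lt_succ_iff] using hj) (Submodule.mem_map_of_mem hh)
  · obtain ⟨s, rfl⟩ := Nat.exists_eq_add_of_le hj
    obtain ⟨u, hu, hlead⟩ := hk i (d i) (by simp)
      (hd i _ hj halive (Submodule.mem_map_of_mem hh))
    have hpos' : 0 < rest c k (bump s (i, d i)) := hpos
    refine ⟨u.mapDomain (bump s), ⟨bump_mem_limRelGe (v := (i, d i)) hc hu.1 halive, ?_, ?_⟩, ?_⟩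
    · refine (T k).bump_mem u hu.2.1 s fun w hw => hc.alive_of_rest_pos ?_
      have := hu.2.2 w hw
      rw [rest_bump] at hpos' ⊢
      omega
    · intro w hw
      obtain ⟨x, hx, rfl⟩ := mapDomain_bump_ne_zero hw
      have := hu.2.2 x hx
      change rest c k (bump s (i, d i)) ≤ _
      rw [rest_bump, rest_bump]
      omega
    · rw [← hlead]
      exact lead_mapDomain_bump c (i, d i) s u

theorem eventually_rest_eq_of_limRest_eq [Finite ι] (c : ℕ → ι → ℤ) :
    ∀ᶠ k in (hyperfilter ℕ : Filter ℕ), ∀ v w : ι × ℕ,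
      limRest c v = limRest c w → rest c k v = rest c k w := by
  have : ∀ᶠ k in (hyperfilter ℕ : Filter ℕ), ∀ i i' : ι, ∀ a : ℤ,
      (∀ᶠ m in (hyperfilter ℕ : Filter ℕ), c m i - c m i' = a) → c k i - c k i' = a := by
    refine eventually_all.mpr fun i => eventually_all.mpr fun i' => ?_
    by_cases hex : ∃ a, ∀ᶠ m in (hyperfilter ℕ : Filter ℕ), c m i - c m i' = a
    · obtain ⟨a, ha⟩ := hex
      filter_upwards [ha] with k hk b hb
      obtain ⟨m, h1, h2⟩ := (ha.and hb).exists
      omega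
    · exact Eventually.of_forall fun k a ha => absurd ⟨a, ha⟩ hex
  filter_upwards [this] with k hk v w hvw
  have := hk v.1 w.1 (v.2 - w.2) (by
    filter_upwards [limRest_eq.mp hvw] with m hm
    simp only [rest] at hm
    omega)
  simp only [rest]
  omega

theorem rest_pos_of_isLead [Finite ι] {T : ℕ → ShiftSystem ι} {c : ℕ → ι → ℤ} (hc : IsClock T c)
    {k : ℕ} (heq : ∀ v w : ι × ℕ, limRest c v = limRest c w → rest c k v = rest c k w)
    {v : ι × ℕ} {h : ι × ℕ →₀ ℤ} (hv : h v ≠ 0) (hh : h ∈ limRelGe T c v)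
    (htop : ∀ᶠ m in (hyperfilter ℕ : Filter ℕ), (T m).life v.1 ≠ ⊤)
    (hneg : ∀ w, h w ≠ 0 → rest c k w ≤ 0 → h w < 0) : 0 < rest c k v := by
  by_contra! hle
  have h1 : ∀ᶠ m in (hyperfilter ℕ : Filter ℕ), ∀ w ∈ h.support, 0 < h w →
      rest c m v < rest c m w := by
    refine (Finset.eventually_all _).mpr fun w hw => ?_
    by_cases hpos : 0 < h w
    · have hw' := Finsupp.mem_support_iff.mp hw
      have hne : limRest c v ≠ limRest c w := fun h' => by
        have := heq v w h'
        have := hneg w hw' (by omega)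
        omega
      filter_upwards [limRest_lt.mp (lt_of_le_of_ne (hh.2 w hw') hne)] with m hm _ using hm
    · exact Eventually.of_forall fun m h' => absurd h' hpos
  obtain ⟨m, hm1, hm2, hm3⟩ := (htop.and (h1.and hh.1)).exists
  have hpos := hc.rest_pos_of_alive_of_ne_top ((T m).alive_of_mem h hm3 v hv) hm1
  set s := (rest c m v).toNat with hs
  have hdead := (T m).alive_bump_of_mem h hm3 s (fun w hw => hc.alive_of_rest_pos (by
    have := hm2 w (Finsupp.mem_support_iff.mpr hw.ne') hw
    rw [rest_bump]; omega)) v hv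
  have := hc.rest_pos_of_alive_of_ne_top hdead hm1
  rw [rest_bump] at this
  omega

theorem eventually_mem_rel [Finite ι] {T : ℕ → ShiftSystem ι} {c : ℕ → ι → ℤ} (hc : IsClock T c) :
    ∀ᶠ k in (hyperfilter ℕ : Filter ℕ), ∀ h ∈ limRel T,
      (∀ w, h w ≠ 0 → rest c k w ≤ 0 → h w < 0 ∧ (T k).life w.1 ≠ ⊤) → h ∈ (T k).rel := by
  have htop : ∀ᶠ k in (hyperfilter ℕ : Filter ℕ), ∀ i, (T k).life i ≠ ⊤ →
      ∀ᶠ m in (hyperfilter ℕ : Filter ℕ), (T m).life i ≠ ⊤ := by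
    refine eventually_all.mpr fun i => ?_
    by_cases hi : ∀ᶠ m in (hyperfilter ℕ : Filter ℕ), (T m).life i ≠ ⊤
    · exact Eventually.of_forall fun _ _ => hi
    · filter_upwards [Ultrafilter.eventually_not.mpr hi] with k hk hk'
      exact absurd hk' hk
  filter_upwards [htop, eventually_rest_eq_of_limRest_eq c, eventually_exists_reducer hc]
    with k htop heq hred
  suffices H : ∀ v, ∀ h ∈ limRelGe T c v, h v ≠ 0 →
      (∀ w, h w ≠ 0 → rest c k w ≤ 0 → h w < 0 ∧ (T k).life w.1 ≠ ⊤) → h ∈ (T k).rel by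
    intro h hh hneg
    rcases eq_or_ne h 0 with rfl | hne
    · exact zero_mem _
    obtain ⟨v, hv, hmin⟩ := Finset.exists_min_image h.support (limRest c)
      (Finsupp.support_nonempty_iff.mpr hne)
    exact H v h ⟨hh, fun w hw => hmin w (Finsupp.mem_support_iff.mpr hw)⟩
      (Finsupp.mem_support_iff.mp hv) hneg
  intro v
  induction v using (wellFounded_limRest_gt c).induction with
  | _ v ih =>
  intro h hh hv hneg
  have hpos : 0 < rest c k v := by
    by_contra! hle
    exact hle.not_gt (rest_pos_of_isLead hc heq hv hh (htop _ (hneg v hv hle).2)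
      fun w hw hw' => (hneg w hw hw').1)
  have halive : ∀ᶠ m in (hyperfilter ℕ : Filter ℕ), (v.2 : ℕ∞) < (T m).life v.1 := by
    filter_upwards [hh.1] with m hm using (T m).alive_of_mem h hm v hv
  obtain ⟨u, hu, hlead⟩ := hred v halive hpos h hh
  suffices hsub : h - u ∈ (T k).rel by simpa using add_mem hsub hu.2.1
  have hmem : h - u ∈ limRelGe T c v := sub_mem hh hu.1
  rcases eq_or_ne (h - u) 0 with hzero | hne
  · rw [hzero]; exact zero_mem _
  obtain ⟨w, hw, hmin⟩ := Finset.exists_min_image (h - u).support (limRest c)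
    (Finsupp.support_nonempty_iff.mpr hne)
  have hw' := Finsupp.mem_support_iff.mp hw
  have hvw : limRest c v ≠ limRest c w := fun h' =>
    hw' (eq_zero_of_lead_eq_zero (v := v) (by rw [map_sub, hlead, sub_self]) h'.symm)
  refine ih w (lt_of_le_of_ne (hmem.2 w hw') hvw) (h - u)
    ⟨hmem.1, fun x hx => hmin x (Finsupp.mem_support_iff.mpr hx)⟩ hw' fun x hx hx' => ?_
  have hux : u x = 0 := by
    by_contra hux
    have := hu.2.2 x hux
    omega
  rw [Finsupp.sub_apply, hux, sub_zero] at hx ⊢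
  exact hneg x hx hx'

/-- There is no infinite sequence of shift systems and binomials in which every system fails
the binomial of the same index but satisfies all earlier ones. -/
theorem false_of_bad_sequence [Finite ι] (T : ℕ → ShiftSystem ι) (f g : ℕ → (ι × ℕ →₀ ℕ))
    (hf : ∀ k, ∀ v ∈ (f k).support, (v.2 : ℕ∞) < (T k).life v.1)
    (hnot : ∀ k, toInt (f k) - toInt (g k) ∉ (T k).rel)
    (hmem : ∀ k m, k < m → (∀ v ∈ (f k).support, (v.2 : ℕ∞) < (T m).life v.1) →
      toInt (f k) - toInt (g k) ∈ (T m).rel) : False := by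
  classical
  set b : ℕ → ℕ := fun k => k + 1 + ((f k).support ∪ (g k).support).sup Prod.snd with hb
  set c : ℕ → ι → ℤ := fun k i =>
    if (T k).life i = ⊤ then (b k : ℤ) else ((T k).life i).toNat with hcdef
  have hc : IsClock T c := by
    refine ⟨fun k i a ha => by simp [hcdef, ha], fun k i ha => ?_⟩
    simp only [hcdef, ha, if_true, hb]
    push_cast
    omega
  have hlife : ∀ᶠ k in (hyperfilter ℕ : Filter ℕ), ∀ i,
      ∀ᶠ m in (hyperfilter ℕ : Filter ℕ), (T k).life i ≤ (T m).life i :=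
    eventually_all.mpr fun i => eventually_eventually_le fun k => (T k).life i
  obtain ⟨k, hk1, hk2⟩ := (hlife.and (eventually_mem_rel hc)).exists
  refine hnot k (hk2 _ ?_ fun w hw hw' => ?_)
  · filter_upwards [eventually_all.mpr hk1, eventually_gt_hyperfilter k] with m hm hkm
    exact hmem k m hkm fun v hv => (hf k v hv).trans_le (hm v.1)
  · have htop : (T k).life w.1 ≠ ⊤ := fun ht => by
      have hsup : w ∈ (f k).support ∪ (g k).support := by
        by_contra hcon
        simp only [Finset.mem_union, Finsupp.mem_support_iff, not_or, not_not] at hcon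
        simp [toInt_apply, hcon.1, hcon.2] at hw
      have := Finset.le_sup (f := Prod.snd) hsup
      simp only [rest, hcdef, ht, if_true, hb] at hw'
      push_cast at hw'
      omega
    have hfw : f k w = 0 := by
      by_contra hfw
      have := hc.rest_pos_of_alive_of_ne_top (hf k w (Finsupp.mem_support_iff.mpr hfw)) htop
      omega
    simp only [Finsupp.sub_apply, toInt_apply, hfw, Nat.cast_zero, zero_sub] at hw ⊢
    exact ⟨by omega, htop⟩

end ShiftSystem

section PrimeSigmaIdeal

theorem exists_prime_of_notMem {R : Type*} [CommRing R] {σ : R →+* R} {I : Ideal R}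
    (hwm : IsWellMixed σ I) (hrad : I.IsRadical) {b : R} (hb : b ∉ I) :
    ∃ P : Ideal R, P.IsPrime ∧ IsSigmaIdeal σ P ∧ I ≤ P ∧ b ∉ P := by
  obtain ⟨P, hP, hbP⟩ : ∃ P ∈ I.minimalPrimes, b ∉ P := by
    rw [← hrad.radical, ← Ideal.sInf_minimalPrimes, Submodule.mem_sInf] at hb
    push Not at hb
    exact hb
  have hprime : P.IsPrime := hP.1.1
  refine ⟨P, hprime, fun a ha => ?_, hP.1.2, hbP⟩
  obtain ⟨s, hs, hsa⟩ : ∃ s, s ∉ P ∧ s * a ∈ I := by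
    by_contra! hcon
    have hdisj : Disjoint (I : Set R) (P.primeCompl ⊔ Submonoid.powers a : Submonoid R) := by
      rw [Set.disjoint_right]
      intro x hx hxI
      obtain ⟨s, hs, _, ⟨k, rfl⟩, rfl⟩ := Submonoid.mem_sup.mp hx
      refine hcon s hs (hrad ⟨k + 1, ?_⟩)
      have : (s * a) ^ (k + 1) = s ^ k * a * (s * a ^ k) := by ring
      rw [this]
      exact I.mul_mem_left _ hxI
    obtain ⟨Q, hQ, hIQ, hdisjQ⟩ := Ideal.exists_le_prime_disjoint I _ hdisj
    have hnot : ∀ x, x ∉ P → x ∉ Q := fun x hx hxQ =>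
      Set.disjoint_left.mp hdisjQ hxQ (Submonoid.mem_sup_left hx)
    have haQ : a ∉ Q := fun h =>
      Set.disjoint_left.mp hdisjQ h (Submonoid.mem_sup_right (Submonoid.mem_powers a))
    exact haQ (hP.2 ⟨hQ, hIQ⟩ (fun x hx => by_contra fun h => hnot x h hx) ha)
  exact (hprime.mem_or_mem (hP.1.2 (hwm s a hsa))).resolve_left hs

theorem IsSigmaIdeal.iterate_mem {R : Type*} [CommRing R] {σ : R →+* R} {I : Ideal R}
    (hI : IsSigmaIdeal σ I) (s : ℕ) {a : R} (ha : a ∈ I) : σ^[s] a ∈ I := by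
  induction s with
  | zero => exact ha
  | succ s ih => rw [Function.iterate_succ_apply']; exact hI _ ih

theorem rwmClosure_spec {R : Type*} [CommRing R] (σ : R →+* R) (F : Set R) :
    F ⊆ rwmClosure σ F ∧ IsSigmaIdeal σ (rwmClosure σ F) ∧ IsWellMixed σ (rwmClosure σ F) ∧
      (rwmClosure σ F).IsRadical := by
  refine ⟨fun x hx => ?_, fun a ha => ?_, fun a b hab => ?_, fun a ⟨k, hk⟩ => ?_⟩ <;>
    simp only [rwmClosure, SetLike.mem_coe, Submodule.mem_sInf, Set.mem_ofPred_eq] at *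
  · exact fun I hI => hI.1 hx
  · exact fun I hI => hI.2.1 a (ha I hI)
  · exact fun I hI => hI.2.2.1 a b (hab I hI)
  · exact fun I hI => hI.2.2.2 ⟨k, hk I hI⟩

variable {K : Type*} [Field K] {n : ℕ} (σK : K →+* K)

theorem shift_monomial_one (f : Fin n × ℕ →₀ ℕ) :
    shift σK (MvPolynomial.monomial f 1) =
      MvPolynomial.monomial (f.mapDomain (bump 1)) (1 : K) := by
  rw [shift, MvPolynomial.eval₂Hom_monomial, map_one, one_mul, MvPolynomial.monomial_eq, map_one,
    one_mul, Finsupp.prod_mapDomain_index_inj (bump_injective 1)]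
  rfl

theorem iterate_shift_monomial_one (s : ℕ) (f : Fin n × ℕ →₀ ℕ) :
    (shift σK)^[s] (MvPolynomial.monomial f 1) =
      MvPolynomial.monomial (f.mapDomain (bump s)) (1 : K) := by
  induction s with
  | zero => rw [show (bump 0 : Fin n × ℕ → Fin n × ℕ) = id from rfl]; simp
  | succ s ih =>
    rw [Function.iterate_succ_apply', ih, shift_monomial_one, ← Finsupp.mapDomain_comp]
    rfl

theorem exists_monom_eq_monomial (f : Fin n → Polynomial ℕ) :
    ∃ e : Fin n × ℕ →₀ ℕ, monom σK f = MvPolynomial.monomial e 1 := by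
  suffices h : monom σK f ∈ MonoidHom.mrange (MvPolynomial.monomialOneHom K (Fin n × ℕ)) by
    obtain ⟨e, he⟩ := h
    exact ⟨e.toAdd, he.symm⟩
  refine Submonoid.prod_mem _ fun i _ => ?_
  unfold ypow sexp
  refine Submonoid.prod_mem _ fun j _ => Submonoid.pow_mem _ ?_ _
  refine ⟨Multiplicative.ofAdd ((Finsupp.single (i, 0) 1).mapDomain (bump j)), ?_⟩
  exact (iterate_shift_monomial_one σK j _).symm

variable {P : Ideal (DPoly K n)}

theorem monomial_one_sub_bump_mem {σK : K →+* K} (hσ : IsSigmaIdeal (shift σK) P) (s : ℕ)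
    {f g : Fin n × ℕ →₀ ℕ}
    (h : MvPolynomial.monomial f 1 - MvPolynomial.monomial g 1 ∈ P) :
    MvPolynomial.monomial (f.mapDomain (bump s)) 1 -
      MvPolynomial.monomial (g.mapDomain (bump s)) 1 ∈ P := by
  have := hσ.iterate_mem s h
  rwa [← RingHom.coe_pow, map_sub, RingHom.coe_pow, iterate_shift_monomial_one,
    iterate_shift_monomial_one] at this

theorem monomial_one_notMem_iff (hP : P.IsPrime) {f : Fin n × ℕ →₀ ℕ} :
    MvPolynomial.monomial f 1 ∉ P ↔ ∀ v ∈ f.support, MvPolynomial.X v ∉ P := by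
  rw [MvPolynomial.monomial_eq, map_one, one_mul, Finsupp.prod, hP.prod_mem_iff]
  push Not
  refine forall₂_congr fun v hv => not_congr ?_
  exact hP.pow_mem_iff_mem _ (Nat.pos_of_ne_zero (Finsupp.mem_support_iff.mp hv))

/-- The first `j` for which the variable `(i, j)` belongs to `P`. -/
noncomputable def lifeOf (P : Ideal (DPoly K n)) (i : Fin n) : ℕ∞ :=
  open Classical in
  if h : ∃ j, (MvPolynomial.X (i, j) : DPoly K n) ∈ P then (Nat.find h : ℕ∞) else ⊤

theorem lt_lifeOf_iff {σK : K →+* K} (hσ : IsSigmaIdeal (shift σK) P) (v : Fin n × ℕ) :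
    (v.2 : ℕ∞) < lifeOf P v.1 ↔ MvPolynomial.X v ∉ P := by
  classical
  obtain ⟨i, j⟩ := v
  have hup : ∀ s l, (MvPolynomial.X (i, l) : DPoly K n) ∈ P →
      (MvPolynomial.X (i, l + s) : DPoly K n) ∈ P := fun s l h => by
    have := hσ.iterate_mem s h
    rw [MvPolynomial.X, iterate_shift_monomial_one, Finsupp.mapDomain_single] at this
    exact this
  unfold lifeOf
  split_ifs with h
  · simp only [Nat.cast_lt, Nat.lt_find_iff]
    refine ⟨fun h' => h' j le_rfl, fun h' m hm hmem => h' ?_⟩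
    have := hup (j - m) m hmem
    rwa [Nat.add_sub_cancel' hm] at this
  · push Not at h
    simp [h j]

/-- Exponent differences of the binomials in `P` both of whose monomials lie outside `P`. -/
noncomputable def binomialRel (hP : P.IsPrime) : Submodule ℤ (Fin n × ℕ →₀ ℤ) :=
  AddSubgroup.toIntSubmodule
  { carrier := {h | ∃ f g : Fin n × ℕ →₀ ℕ, MvPolynomial.monomial f 1 ∉ P ∧
      MvPolynomial.monomial g 1 ∉ P ∧
      MvPolynomial.monomial f 1 - MvPolynomial.monomial g 1 ∈ P ∧ toInt f - toInt g = h}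
    zero_mem' := by
      refine ⟨0, 0, ?_, ?_, by simp, by simp⟩ <;>
        exact (monomial_one_notMem_iff hP).mpr (by simp)
    add_mem' := by
      rintro _ _ ⟨f, g, hf, hg, hfg, rfl⟩ ⟨f', g', hf', hg', hfg', rfl⟩
      have hmul : ∀ a b : Fin n × ℕ →₀ ℕ, (MvPolynomial.monomial (a + b) 1 : DPoly K n) =
          MvPolynomial.monomial a 1 * MvPolynomial.monomial b 1 := fun a b => by
        rw [MvPolynomial.monomial_mul, one_mul]
      refine ⟨f + f', g + g', ?_, ?_, ?_, ?_⟩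
      · rw [hmul]; exact fun h => (hP.mem_or_mem h).elim hf hf'
      · rw [hmul]; exact fun h => (hP.mem_or_mem h).elim hg hg'
      · rw [hmul, hmul]; exact P.mul_sub_mul_mem hfg hfg'
      · rw [map_add, map_add]; abel
    neg_mem' := by
      rintro _ ⟨f, g, hf, hg, hfg, rfl⟩
      exact ⟨g, f, hg, hf, by rw [← neg_sub]; exact P.neg_mem hfg, by abel⟩ }

theorem mem_binomialRel {hP : P.IsPrime} {h : Fin n × ℕ →₀ ℤ} :
    h ∈ binomialRel hP ↔ ∃ f g : Fin n × ℕ →₀ ℕ, MvPolynomial.monomial f 1 ∉ P ∧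
      MvPolynomial.monomial g 1 ∉ P ∧
      MvPolynomial.monomial f 1 - MvPolynomial.monomial g 1 ∈ P ∧ toInt f - toInt g = h :=
  Iff.rfl

theorem monomial_one_sub_mem_of_mem_binomialRel {hP : P.IsPrime} {f g : Fin n × ℕ →₀ ℕ}
    (h : toInt f - toInt g ∈ binomialRel hP) :
    MvPolynomial.monomial f 1 - MvPolynomial.monomial g 1 ∈ P := by
  obtain ⟨f', g', -, hg', hfg', heq⟩ := mem_binomialRel.mp h
  have hadd : g' + f = f' + g := toInt_injective <| by
    rw [map_add, map_add]
    rw [sub_eq_sub_iff_add_eq_add] at heq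
    rw [heq, add_comm]
  have hmul : ∀ a b : Fin n × ℕ →₀ ℕ, (MvPolynomial.monomial (a + b) 1 : DPoly K n) =
      MvPolynomial.monomial a 1 * MvPolynomial.monomial b 1 := fun a b => by
    rw [MvPolynomial.monomial_mul, one_mul]
  refine (hP.mem_or_mem ?_).resolve_left hg'
  have : MvPolynomial.monomial g' 1 * (MvPolynomial.monomial f 1 - MvPolynomial.monomial g 1) =
      (MvPolynomial.monomial f' 1 - MvPolynomial.monomial g' 1) *
        (MvPolynomial.monomial g 1 : DPoly K n) := by
    rw [mul_sub, sub_mul, ← hmul, ← hmul, ← hmul, hadd]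
  rw [this]
  exact P.mul_mem_right _ hfg'

/-- The shift system of a prime σ-ideal. -/
noncomputable def systemOf {σK : K →+* K} (hP : P.IsPrime) (hσ : IsSigmaIdeal (shift σK) P) :
    ShiftSystem (Fin n) where
  life := lifeOf P
  rel := binomialRel hP
  alive_of_mem := by
    rintro _ ⟨f, g, hf, hg, -, rfl⟩ v hv
    rw [lt_lifeOf_iff hσ]
    by_cases hfv : f v = 0
    · refine (monomial_one_notMem_iff hP).mp hg v (Finsupp.mem_support_iff.mpr fun hgv => hv ?_)
      simp [hfv, hgv]
    · exact (monomial_one_notMem_iff hP).mp hf v (Finsupp.mem_support_iff.mpr hfv)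
  alive_bump_of_mem := by
    classical
    intro h hh s hpos v hv
    rw [← toInt_toNat_sub h] at hh
    have hmem := monomial_one_sub_bump_mem hσ s (monomial_one_sub_mem_of_mem_binomialRel hh)
    rcases lt_or_gt_of_ne hv with hv | hv
    · rw [lt_lifeOf_iff hσ]
      have hnot : MvPolynomial.monomial ((h.mapRange Int.toNat rfl).mapDomain (bump s)) 1 ∉ P := by
        refine (monomial_one_notMem_iff hP).mpr fun w hw => ?_
        obtain ⟨u, hu, rfl⟩ := Finset.mem_image.mp (Finsupp.mapDomain_support hw)
        rw [← lt_lifeOf_iff hσ]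
        exact hpos u (by simpa using hu)
      refine (monomial_one_notMem_iff hP).mp (fun h' => hnot ((P.sub_mem_iff_left h').mp hmem)) _ ?_
      rw [Finsupp.mem_support_iff, Finsupp.mapDomain_apply (bump_injective s)]
      simpa using hv
    · exact hpos v hv
  bump_mem := by
    classical
    intro h hh s halive
    rw [← toInt_toNat_sub h] at hh
    have hmem := monomial_one_sub_bump_mem hσ s (monomial_one_sub_mem_of_mem_binomialRel hh)
    refine ⟨_, _, (monomial_one_notMem_iff hP).mpr fun w hw => ?_,
      (monomial_one_notMem_iff hP).mpr fun w hw => ?_, hmem, ?_⟩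
    · obtain ⟨u, hu, rfl⟩ := Finset.mem_image.mp (Finsupp.mapDomain_support hw)
      rw [← lt_lifeOf_iff hσ]
      exact halive u (fun h0 => by simp [h0] at hu)
    · obtain ⟨u, hu, rfl⟩ := Finset.mem_image.mp (Finsupp.mapDomain_support hw)
      rw [← lt_lifeOf_iff hσ]
      exact halive u (fun h0 => by simp [h0] at hu)
    · rw [toInt_mapDomain, toInt_mapDomain]
      conv_rhs => rw [← toInt_toNat_sub h]
      exact (map_sub (Finsupp.mapDomain.addMonoidHom (M := ℤ) (bump (ι := Fin n) s)) _ _).symm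

end PrimeSigmaIdeal

/-- There is no infinite strictly ascending chain of radical well-mixed σ-ideals
of `K{y_1,…,y_n}` each of which is the radical well-mixed closure of a set of pure binomials. -/
theorem stmt12 {K : Type*} [Field K] [CharZero K] {n : ℕ} (σK : K →+* K) :
    ¬ ∃ c : ℕ → Ideal (DPoly K n),
      (∀ k : ℕ, ∃ S : Set (DPoly K n), (∀ p ∈ S, IsPureBinomial σK p) ∧
        c k = rwmClosure (shift σK) S) ∧
      ∀ k : ℕ, c k < c (k + 1) := by
  rintro ⟨c, hc, hlt⟩
  have hmono : StrictMono c := strictMono_nat_of_lt_succ hlt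
  have key : ∀ k, ∃ (P : Ideal (DPoly K n)) (f g : Fin n × ℕ →₀ ℕ), P.IsPrime ∧
      IsSigmaIdeal (shift σK) P ∧ c k ≤ P ∧ MvPolynomial.monomial f 1 ∉ P ∧
      MvPolynomial.monomial f 1 - MvPolynomial.monomial g 1 ∉ P ∧
      MvPolynomial.monomial f 1 - MvPolynomial.monomial g 1 ∈ c (k + 1) := by
    intro k
    obtain ⟨S, -, hS⟩ := hc k
    obtain ⟨S', hS'bin, hS'⟩ := hc (k + 1)
    obtain ⟨hS1, hS2, hS3, hS4⟩ := hS ▸ rwmClosure_spec (shift σK) S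
    have hsub : ¬ S' ⊆ c k := fun h =>
      (hlt k).not_ge (hS' ▸ sInf_le (show _ ∧ _ from ⟨h, hS2, hS3, hS4⟩))
    obtain ⟨b, hbS', hb⟩ := Set.not_subset.mp hsub
    have hbmem : b ∈ c (k + 1) := hS' ▸ (rwmClosure_spec (shift σK) S').1 hbS'
    obtain ⟨P, hP, hσ, hle, hbP⟩ := exists_prime_of_notMem hS3 hS4 hb
    obtain ⟨p, q, rfl⟩ := hS'bin b hbS'
    obtain ⟨f, hf⟩ := exists_monom_eq_monomial σK p
    obtain ⟨g, hg⟩ := exists_monom_eq_monomial σK q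
    rw [hf, hg] at hbmem hbP
    by_cases hfP : MvPolynomial.monomial f 1 ∈ P
    · refine ⟨P, g, f, hP, hσ, hle, fun hgP => hbP (P.sub_mem hfP hgP), fun h => hbP ?_, ?_⟩
      · rw [← neg_sub]; exact P.neg_mem h
      · rw [← neg_sub]; exact (c (k + 1)).neg_mem hbmem
    · exact ⟨P, f, g, hP, hσ, hle, hfP, hbP, hbmem⟩
  choose P f g hP hσ hle hf hnot hmem using key
  refine ShiftSystem.false_of_bad_sequence (fun k => systemOf (hP k) (hσ k)) f g
    (fun k v hv => (lt_lifeOf_iff (hσ k) v).mpr ((monomial_one_notMem_iff (hP k)).mp (hf k) v hv))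
    (fun k h => hnot k (monomial_one_sub_mem_of_mem_binomialRel (hP := hP k) h))
    (fun k m hkm hv => ?_)
  have hfm : MvPolynomial.monomial (f k) 1 ∉ P m :=
    (monomial_one_notMem_iff (hP m)).mpr fun v hv' => (lt_lifeOf_iff (hσ m) v).mp (hv v hv')
  have hsub := hle m (hmono.monotone (Nat.succ_le_of_lt hkm) (hmem k))
  exact ⟨f k, g k, hfm, fun hg => hfm (((P m).sub_mem_iff_left hg).mp hsub), hsub, rfl⟩
end
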